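/- arXiv:2510.03373 — 4 statements merged into one kernel-verified Lean document; each statement's English description precedes it below -/
import Mathlib

section
/- For all nondecreasing sequences a = (a_n)_{n≥1} and b = (b_n)_{n≥1} of integers with a₁ ≥ 2 and b₁ ≥ 2, one has |E'(σ(a)) − E'(σ(b))| ≤ 2·|E(a) − E(b)|. (Equivalently, the map T sending the classical Engel expansion with digits (c_n) to the modified Engel expansion with digits (c_n + n − 1) is a Lipschitz transformation of (0,1] with Lipschitz constant 2.) -/
open Filter

noncomputable section

/-- The classical Engel series `E(c) = ∑_{n≥1} 1/(c₁c₂⋯c_n)` (0-based: `c 0 = c₁`). -/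
def engel (c : ℕ → ℕ) : ℝ :=
  ∑' n : ℕ, 1 / ∏ i ∈ Finset.range (n + 1), (c i : ℝ)

/-- The modified Engel series
`E'(c) = 1/c₁ + ∑_{n≥1} 1/((c₁−1)(c₂−1)⋯(c_n−1)·c_{n+1})` (0-based: `c 0 = c₁`). -/
def modEngel (c : ℕ → ℕ) : ℝ :=
  1 / (c 0 : ℝ) +
    ∑' n : ℕ, 1 / ((∏ i ∈ Finset.range (n + 1), ((c i : ℝ) - 1)) * (c (n + 1) : ℝ))

/-- The digit shift `σ(c)_n = c_n + n − 1` (0-based: `σ(c) (n-1) = c (n-1) + (n-1)`). -/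
def engelShift (c : ℕ → ℕ) : ℕ → ℕ := fun n => c n + n

/-- The Pierce series in Perron notation
`Π(c) = ∑_{n≥0} (−1)^n/((c₁−1)⋯(c_n−1)(c_{n+1}−1))` (0-based: `c 0 = c₁`). -/
def pierce (c : ℕ → ℕ) : ℝ :=
  ∑' n : ℕ, (-1 : ℝ) ^ n / ((∏ i ∈ Finset.range n, ((c i : ℝ) - 1)) * ((c n : ℝ) - 1))

/-- The traditional Pierce series `Π̃(d) = ∑_{n≥1} (−1)^{n+1}/(d₁d₂⋯d_n)` (0-based: `d 0 = d₁`). -/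
def pierceTrad (d : ℕ → ℕ) : ℝ :=
  ∑' n : ℕ, (-1 : ℝ) ^ n / ∏ i ∈ Finset.range (n + 1), (d i : ℝ)

end

def tl (c : ℕ → ℕ) : ℕ → ℕ := fun n => c (n + 1)

noncomputable def gk (k : ℕ) (c : ℕ → ℕ) : ℝ := modEngel (fun n => c n + n + k)

def ok (c : ℕ → ℕ) : Prop := Monotone c ∧ 2 ≤ c 0

lemma ok.tl {c : ℕ → ℕ} (h : ok c) : ok (tl c) :=
  ⟨fun _ _ hij => h.1 (by omega), h.2.trans (h.1 (by omega))⟩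

lemma ok.ge {c : ℕ → ℕ} (h : ok c) (n : ℕ) : 2 ≤ c n := h.2.trans (h.1 (by omega))

lemma ok.geR {c : ℕ → ℕ} (h : ok c) (n : ℕ) : (2 : ℝ) ≤ c n := by exact_mod_cast h.ge n

lemma ok.tl0 {c : ℕ → ℕ} (h : ok c) : (c 0 : ℝ) ≤ _root_.tl c 0 := by
  have : c 0 ≤ c 1 := h.1 (by omega)
  exact_mod_cast this

lemma engel_term_le {c : ℕ → ℕ} (h : ok c) (n : ℕ) :
    1 / ∏ i ∈ Finset.range (n + 1), (c i : ℝ) ≤ (1 / (c 0 : ℝ)) ^ (n + 1) := by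
  have h0 := h.geR 0
  rw [div_pow, one_pow]
  apply one_div_le_one_div_of_le (by positivity)
  calc (c 0 : ℝ) ^ (n + 1) = ∏ i ∈ Finset.range (n + 1), (c 0 : ℝ) := by simp
    _ ≤ _ := Finset.prod_le_prod (fun _ _ => by positivity)
      (fun i _ => by exact_mod_cast h.1 (Nat.zero_le i))

lemma geo {x : ℝ} (hx : 2 ≤ x) : HasSum (fun n : ℕ => (1 / x) ^ (n + 1)) (1 / (x - 1)) := by
  have h1 : 1 / x < 1 := by rw [div_lt_one] <;> linarith
  have := (hasSum_geometric_of_lt_one (by positivity) h1).mul_left (1 / x)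
  have e1 : (fun n : ℕ => (1 / x) ^ (n + 1)) = fun n : ℕ => 1 / x * (1 / x) ^ n := by
    funext n; ring
  have e2 : 1 / (x - 1) = 1 / x * (1 - 1 / x)⁻¹ := by
    have : x - 1 ≠ 0 := by linarith
    have : x ≠ 0 := by linarith
    field_simp
  rw [e1, e2]
  exact this

lemma engel_nn (c : ℕ → ℕ) (n : ℕ) : 0 ≤ 1 / ∏ i ∈ Finset.range (n + 1), (c i : ℝ) := by
  positivity

lemma engel_summable {c : ℕ → ℕ} (h : ok c) :
    Summable (fun n : ℕ => 1 / ∏ i ∈ Finset.range (n + 1), (c i : ℝ)) :=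
  Summable.of_nonneg_of_le (engel_nn c) (engel_term_le h) (geo (h.geR 0)).summable

lemma engel_nonneg (c : ℕ → ℕ) : 0 ≤ engel c := tsum_nonneg (engel_nn c)

lemma engel_le {c : ℕ → ℕ} (h : ok c) : engel c ≤ 1 / ((c 0 : ℝ) - 1) := by
  rw [← (geo (h.geR 0)).tsum_eq]
  exact (engel_summable h).tsum_le_tsum (engel_term_le h) (geo (h.geR 0)).summable

lemma engel_split {c : ℕ → ℕ} (h : ok c) :
    engel c = 1 / (c 0 : ℝ) + ∑' n : ℕ, 1 / ∏ i ∈ Finset.range (n + 2), (c i : ℝ) := by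
  unfold engel
  rw [(engel_summable h).tsum_eq_zero_add]
  simp

lemma engel_rec {c : ℕ → ℕ} (h : ok c) :
    engel c = 1 / (c 0 : ℝ) + engel (tl c) / c 0 := by
  rw [engel_split h]
  congr 1
  unfold engel
  rw [← tsum_div_const]
  congr 1
  funext n
  rw [Finset.prod_range_succ']
  simp only [tl]
  rw [div_div]

lemma gk_nn {c : ℕ → ℕ} (h : ok c) (k n : ℕ) :
    0 ≤ 1 / ((∏ i ∈ Finset.range (n + 1), (((c i + i + k : ℕ) : ℝ) - 1)) *
      ((c (n + 1) + (n + 1) + k : ℕ) : ℝ)) := by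
  have : 0 ≤ ∏ i ∈ Finset.range (n + 1), (((c i + i + k : ℕ) : ℝ) - 1) := by
    apply Finset.prod_nonneg
    intro i _
    have := h.geR i
    push_cast
    have : (0 : ℝ) ≤ i := by positivity
    have : (0 : ℝ) ≤ k := by positivity
    linarith
  positivity

lemma gk_term_le {c : ℕ → ℕ} (h : ok c) (k n : ℕ) :
    1 / ((∏ i ∈ Finset.range (n + 1), (((c i + i + k : ℕ) : ℝ) - 1)) *
      ((c (n + 1) + (n + 1) + k : ℕ) : ℝ)) ≤ (1 / 2 : ℝ) ^ n := by
  rw [div_pow, one_pow]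
  apply one_div_le_one_div_of_le (by positivity)
  rw [Finset.prod_range_succ']
  have hk : (0 : ℝ) ≤ k := by positivity
  have h1 : (2 : ℝ) ^ n ≤ ∏ i ∈ Finset.range n, (((c (i + 1) + (i + 1) + k : ℕ) : ℝ) - 1) := by
    calc (2 : ℝ) ^ n = ∏ i ∈ Finset.range n, (2 : ℝ) := by simp
      _ ≤ _ := Finset.prod_le_prod (fun _ _ => by positivity) (fun i _ => by
        have := h.geR (i + 1)
        have : (0 : ℝ) ≤ i := by positivity
        push_cast
        linarith)
  have h2 : (1 : ℝ) ≤ ((c 0 + 0 + k : ℕ) : ℝ) - 1 := by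
    have := h.geR 0
    push_cast
    linarith
  have h3 : (1 : ℝ) ≤ ((c (n + 1) + (n + 1) + k : ℕ) : ℝ) := by
    have : 1 ≤ c (n + 1) + (n + 1) + k := by omega
    exact_mod_cast this
  have h0 : (0 : ℝ) < 2 ^ n := by positivity
  have h4 := mul_le_mul h1 h2 zero_le_one (h0.le.trans h1)
  have h5 := mul_le_mul h4 h3 zero_le_one (by nlinarith)
  linarith

lemma gk_summable {c : ℕ → ℕ} (h : ok c) (k : ℕ) :
    Summable (fun n : ℕ => 1 / ((∏ i ∈ Finset.range (n + 1), (((c i + i + k : ℕ) : ℝ) - 1)) *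
      ((c (n + 1) + (n + 1) + k : ℕ) : ℝ))) :=
  Summable.of_nonneg_of_le (gk_nn h k) (gk_term_le h k)
    (summable_geometric_of_lt_one (by norm_num) (by norm_num))

lemma gk_nonneg {c : ℕ → ℕ} (h : ok c) (k : ℕ) : 0 ≤ gk k c := by
  unfold gk modEngel
  exact add_nonneg (by positivity) (tsum_nonneg (gk_nn h k))

lemma tsum_aux (f g : ℕ → ℝ) (x y : ℝ) (hf : Summable f) (h0 : f 0 = x / y)
    (h1 : ∀ n, f (n + 1) = g n / y) : ∑' n, f n = (x + ∑' n, g n) / y := by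
  rw [hf.tsum_eq_zero_add, add_div, ← tsum_div_const, h0]
  simp only [h1]

lemma gk_rec {c : ℕ → ℕ} (h : ok c) (k : ℕ) :
    gk k c = 1 / ((c 0 : ℝ) + k) + gk (k + 1) (tl c) / ((c 0 : ℝ) + k - 1) := by
  unfold gk modEngel
  refine congrArg₂ (· + ·) (by simp) ?_
  refine tsum_aux _ _ _ _ (gk_summable h k) ?_ (fun n => ?_)
  · simp only [tl, zero_add, Finset.prod_range_one]
    rw [div_div]
    push_cast
    ring_nf
  · rw [Finset.prod_range_succ', div_div]
    congr 1
    have : ∀ i : ℕ, ((c (i + 1) + (i + 1) + k : ℕ) : ℝ) = ((tl c i + i + (k + 1) : ℕ) : ℝ) := by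
      intro i; simp only [tl]; push_cast; ring
    simp only [this]
    push_cast
    ring

lemma tsum_le_aux (f g : ℕ → ℝ) (hf : Summable f) (hg : Summable g)
    (h : ∀ n, f n ≤ g n) : ∑' n, f n ≤ ∑' n, g n := hf.tsum_le_tsum h hg

lemma gk_le_engel {c : ℕ → ℕ} (h : ok c) {k : ℕ} (hk : 1 ≤ k) : gk k c ≤ engel c := by
  have h0 := h.geR 0
  have hkR : (1 : ℝ) ≤ k := by exact_mod_cast hk
  rw [engel_split h]
  unfold gk modEngel
  apply add_le_add
  · apply one_div_le_one_div_of_le (by linarith)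
    push_cast
    linarith
  · have hs : Summable (fun n : ℕ => 1 / ∏ i ∈ Finset.range (n + 2), (c i : ℝ)) :=
      (summable_nat_add_iff (f := fun n : ℕ => 1 / ∏ i ∈ Finset.range (n + 1), (c i : ℝ)) 1).2
        (engel_summable h)
    refine tsum_le_aux _ _ (gk_summable h k) hs (fun n => ?_)
    have hp : 0 < ∏ i ∈ Finset.range (n + 2), (c i : ℝ) :=
      Finset.prod_pos (fun i _ => by have := h.geR i; linarith)
    apply one_div_le_one_div_of_le hp
    rw [Finset.prod_range_succ]
    apply mul_le_mul
    · apply Finset.prod_le_prod (fun _ _ => by positivity)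
      intro i _
      have : (0 : ℝ) ≤ i := by positivity
      push_cast
      linarith
    · push_cast
      have : (0 : ℝ) ≤ n := by positivity
      linarith
    · positivity
    · apply Finset.prod_nonneg
      intro i _
      have := h.geR i
      have : (0 : ℝ) ≤ i := by positivity
      push_cast
      linarith

lemma lim_le {x y C : ℝ} (h : ∀ N : ℕ, x ≤ y + C * (1 / 2) ^ N) : x ≤ y := by
  have h1 : Tendsto (fun N : ℕ => y + C * (1 / 2 : ℝ) ^ N) atTop (nhds (y + C * 0)) :=
    ((tendsto_pow_atTop_nhds_zero_of_lt_one (by norm_num) (by norm_num)).const_mul C).const_add y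
  rw [mul_zero, add_zero] at h1
  exact ge_of_tendsto' h1 h

lemma engel_le_one {c : ℕ → ℕ} (h : ok c) : engel c ≤ 1 := by
  refine (engel_le h).trans ?_
  have := h.geR 0
  rw [div_le_one] <;> linarith

lemma gk_le_one {c : ℕ → ℕ} (h : ok c) {k : ℕ} (hk : 1 ≤ k) : gk k c ≤ 1 :=
  (gk_le_engel h hk).trans (engel_le_one h)

lemma gk_le1 (N : ℕ) : ∀ {c : ℕ → ℕ} (_ : ok c) {k : ℕ} (_ : 1 ≤ k),
    gk k c ≤ 1 / ((c 0 : ℝ) + k - 1) + 1 * (1 / 2) ^ N := by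
  induction N with
  | zero =>
    intro c h k hk
    have := gk_le_one h hk
    have h0 := h.geR 0
    have hkR : (1 : ℝ) ≤ k := by exact_mod_cast hk
    have : 0 ≤ 1 / ((c 0 : ℝ) + k - 1) := by
      apply div_nonneg <;> linarith
    simp only [pow_zero]
    linarith
  | succ N ih =>
    intro c h k hk
    have h0 := h.geR 0
    have hkR : (1 : ℝ) ≤ k := by exact_mod_cast hk
    have h1 := ih h.tl (k := k + 1) (by omega)
    have ht := h.tl0
    push_cast at h1
    have h2 : 1 / ((tl c 0 : ℝ) + (k + 1) - 1) ≤ 1 / ((c 0 : ℝ) + k) :=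
      one_div_le_one_div_of_le (by linarith) (by linarith)
    rw [gk_rec h]
    have hd : (2 : ℝ) ≤ (c 0 : ℝ) + k - 1 := by linarith
    have h3 : gk (k + 1) (tl c) / ((c 0 : ℝ) + k - 1) ≤
        (1 / ((c 0 : ℝ) + k) + (1 / 2) ^ N) / ((c 0 : ℝ) + k - 1) := by
      apply div_le_div_of_nonneg_right _ (by linarith)
      linarith
    have h4 : (1 / 2 : ℝ) ^ N / ((c 0 : ℝ) + k - 1) ≤ (1 / 2 : ℝ) ^ N / 2 :=
      div_le_div_of_nonneg_left (by positivity) (by norm_num) hd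
    have h5 : 1 / ((c 0 : ℝ) + k) + (1 / ((c 0 : ℝ) + k)) / ((c 0 : ℝ) + k - 1) =
        1 / ((c 0 : ℝ) + k - 1) := by
      have : (c 0 : ℝ) + k ≠ 0 := by linarith
      have : (c 0 : ℝ) + k - 1 ≠ 0 := by linarith
      field_simp
      ring
    rw [add_div] at h3
    rw [pow_succ]
    linarith

lemma gk_le {c : ℕ → ℕ} (h : ok c) {k : ℕ} (hk : 1 ≤ k) :
    gk k c ≤ 1 / ((c 0 : ℝ) + k - 1) := lim_le (fun N => gk_le1 N h hk)

lemma gk_le_tl {c : ℕ → ℕ} (h : ok c) (k : ℕ) : gk (k + 1) (tl c) ≤ 1 / ((c 0 : ℝ) + k) := by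
  refine (gk_le h.tl (k := k + 1) (by omega)).trans ?_
  have := h.tl0
  have := h.geR 0
  have hk : (0 : ℝ) ≤ k := by positivity
  push_cast
  exact one_div_le_one_div_of_le (by linarith) (by linarith)

lemma gk_le' {c : ℕ → ℕ} (h : ok c) (k : ℕ) :
    gk k c ≤ 1 / ((c 0 : ℝ) + k - 1) := by
  have h0 := h.geR 0
  have hk : (0 : ℝ) ≤ k := by positivity
  have h5 : 1 / ((c 0 : ℝ) + k) + (1 / ((c 0 : ℝ) + k)) / ((c 0 : ℝ) + k - 1) =
      1 / ((c 0 : ℝ) + k - 1) := by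
    have : (c 0 : ℝ) + k ≠ 0 := by linarith
    have : (c 0 : ℝ) + k - 1 ≠ 0 := by linarith
    field_simp
    ring
  have := div_le_div_of_nonneg_right (gk_le_tl h k) (show 0 ≤ (c 0 : ℝ) + k - 1 by linarith)
  rw [gk_rec h]
  linarith

lemma gk_ge {c : ℕ → ℕ} (h : ok c) (k : ℕ) : 1 / ((c 0 : ℝ) + k) ≤ gk k c := by
  rw [gk_rec h]
  have h0 := h.geR 0
  have hk : (0 : ℝ) ≤ k := by positivity
  have := div_nonneg (gk_nonneg h.tl (k + 1)) (show 0 ≤ (c 0 : ℝ) + k - 1 by linarith)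
  linarith

lemma engel_ge {c : ℕ → ℕ} (h : ok c) : 1 / (c 0 : ℝ) ≤ engel c := by
  rw [engel_rec h]
  have := div_nonneg (engel_nonneg (tl c)) (show 0 ≤ (c 0 : ℝ) by positivity)
  linarith

lemma diff_le {m n k : ℝ} (hm : 0 < m) (hn : m ≤ n) (hk : 0 ≤ k) :
    1 / (m + k) - 1 / (n + k) ≤ 1 / m - 1 / n := by
  rw [div_sub_div _ _ (by linarith) (by linarith), div_sub_div _ _ (by linarith) (by linarith)]
  apply div_le_div₀ (by linarith) (by linarith) (by nlinarith)
  nlinarith [mul_nonneg hm.le hk, mul_nonneg (hm.le.trans hn) hk]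

lemma dG {c : ℕ → ℕ} (h : ok c) (k : ℕ) : 1 / ((c 0 : ℝ) + k - 1) - gk k c =
    (1 / ((c 0 : ℝ) + k) - gk (k + 1) (tl c)) / ((c 0 : ℝ) + k - 1) := by
  have h0 := h.geR 0
  have hk : (0 : ℝ) ≤ k := by positivity
  rw [gk_rec h]
  have : (c 0 : ℝ) + k ≠ 0 := by linarith
  have : (c 0 : ℝ) + k - 1 ≠ 0 := by linarith
  field_simp
  ring

lemma dF {c : ℕ → ℕ} (h : ok c) : 1 / ((c 0 : ℝ) - 1) - engel c =
    (1 / ((c 0 : ℝ) - 1) - engel (tl c)) / (c 0 : ℝ) := by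
  have h0 := h.geR 0
  rw [engel_rec h]
  have : (c 0 : ℝ) ≠ 0 := by linarith
  have : (c 0 : ℝ) - 1 ≠ 0 := by linarith
  field_simp
  ring

/-- comparison of the top defects of the tail -/
lemma dTail {c : ℕ → ℕ} (h : ok c) (k : ℕ) {e : ℝ}
    (ht : 1 / ((tl c 0 : ℝ) + (k + 1 : ℕ) - 1) - gk (k + 1) (tl c) ≤
      1 / ((tl c 0 : ℝ) - 1) - engel (tl c) + e) :
    1 / ((c 0 : ℝ) + k) - gk (k + 1) (tl c) ≤ 1 / ((c 0 : ℝ) - 1) - engel (tl c) + e := by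
  have h0 := h.geR 0
  have hk : (0 : ℝ) ≤ k := by positivity
  have hd := diff_le (m := (c 0 : ℝ) - 1) (n := (tl c 0 : ℝ) - 1) (k := (k : ℝ) + 1)
    (by linarith) (by linarith [h.tl0]) (by linarith)
  push_cast at ht
  rw [show (c 0 : ℝ) - 1 + (k + 1) = (c 0 : ℝ) + k by ring,
    show (tl c 0 : ℝ) - 1 + (k + 1) = (tl c 0 : ℝ) + (k + 1) - 1 by ring] at hd
  linarith

lemma defect1 (N : ℕ) : ∀ {c : ℕ → ℕ} (_ : ok c) {k : ℕ} (_ : 1 ≤ k),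
    1 / ((c 0 : ℝ) + k - 1) - gk k c ≤ 1 / ((c 0 : ℝ) - 1) - engel c + 1 * (1 / 2) ^ N := by
  induction N with
  | zero =>
    intro c h k hk
    have h0 := h.geR 0
    have hkR : (1 : ℝ) ≤ k := by exact_mod_cast hk
    have h1 := gk_nonneg h k
    have h2 := engel_le h
    have h3 : 1 / ((c 0 : ℝ) + k - 1) ≤ 1 := by rw [div_le_one] <;> linarith
    simp only [pow_zero]
    linarith
  | succ N ih =>
    intro c h k hk
    have h0 := h.geR 0
    have hkR : (1 : ℝ) ≤ k := by exact_mod_cast hk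
    have h1 := dTail h k (ih h.tl (k := k + 1) (by omega))
    have hnn : 0 ≤ 1 / ((c 0 : ℝ) + k) - gk (k + 1) (tl c) := by linarith [gk_le_tl h k]
    rw [dG h, dF h]
    have h2 := div_le_div₀ (hnn.trans h1) h1 (by linarith : (0 : ℝ) < c 0)
      (by linarith : (c 0 : ℝ) ≤ (c 0 : ℝ) + k - 1)
    rw [add_div] at h2
    have h4 : 1 * (1 / 2 : ℝ) ^ N / (c 0 : ℝ) ≤ 1 * (1 / 2 : ℝ) ^ N / 2 :=
      div_le_div_of_nonneg_left (by positivity) (by norm_num) h0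
    rw [pow_succ]
    linarith

lemma defect {c : ℕ → ℕ} (h : ok c) {k : ℕ} (hk : 1 ≤ k) :
    1 / ((c 0 : ℝ) + k - 1) - gk k c ≤ 1 / ((c 0 : ℝ) - 1) - engel c :=
  lim_le (fun N => defect1 N h hk)

lemma defect0 {c : ℕ → ℕ} (h : ok c) :
    1 / ((c 0 : ℝ) - 1) - gk 0 c ≤ 2 * (1 / ((c 0 : ℝ) - 1) - engel c) := by
  have h0 := h.geR 0
  have h1 := dTail h 0 (e := 0) (by rw [add_zero]; exact defect h.tl (by omega))
  have hnn : 0 ≤ 1 / ((c 0 : ℝ) + (0 : ℕ)) - gk (0 + 1) (tl c) := by linarith [gk_le_tl h 0]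
  have h3 := dG h 0
  rw [dF h]
  simp only [Nat.cast_zero, add_zero] at h1 hnn h3
  rw [h3]
  have h2 := div_le_div₀ (hnn.trans h1) h1 (by linarith : (0 : ℝ) < (c 0 : ℝ) / 2)
      (by linarith : (c 0 : ℝ) / 2 ≤ (c 0 : ℝ) - 1)
  refine h2.trans (le_of_eq ?_)
  have : (c 0 : ℝ) ≠ 0 := by linarith
  field_simp

lemma lt_gk {a b : ℕ → ℕ} (ha : ok a) (hb : ok b) (hab : a 0 < b 0) (k : ℕ) :
    gk k b ≤ gk k a := by
  have h0 := ha.geR 0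
  have hk : (0 : ℝ) ≤ k := by positivity
  have h1 : (a 0 : ℝ) + 1 ≤ b 0 := by exact_mod_cast hab
  refine (gk_le' hb k).trans (le_trans ?_ (gk_ge ha k))
  exact one_div_le_one_div_of_le (by linarith) (by linarith)

lemma lt_engel {a b : ℕ → ℕ} (ha : ok a) (hb : ok b) (hab : a 0 < b 0) :
    engel b ≤ engel a := by
  have h0 := ha.geR 0
  have h1 : (a 0 : ℝ) + 1 ≤ b 0 := by exact_mod_cast hab
  refine (engel_le hb).trans (le_trans ?_ (engel_ge ha))
  exact one_div_le_one_div_of_le (by linarith) (by linarith)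

lemma lt_case {a b : ℕ → ℕ} (ha : ok a) (hb : ok b) (hab : a 0 < b 0) {k : ℕ} (hk : 1 ≤ k) :
    |gk k a - gk k b| ≤ |engel a - engel b| := by
  have h0 := ha.geR 0
  have hkR : (1 : ℝ) ≤ k := by exact_mod_cast hk
  have h1 : (a 0 : ℝ) + 1 ≤ b 0 := by exact_mod_cast hab
  rw [abs_of_nonneg (sub_nonneg.2 (lt_gk ha hb hab k)),
    abs_of_nonneg (sub_nonneg.2 (lt_engel ha hb hab))]
  have hd := diff_le (m := (a 0 : ℝ)) (n := (b 0 : ℝ) - 1) (k := (k : ℝ))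
    (by linarith) (by linarith) (by linarith)
  rw [show (b 0 : ℝ) - 1 + k = (b 0 : ℝ) + k - 1 by ring] at hd
  have h2 := defect hb hk
  have h3 : gk (k + 1) (tl a) / ((a 0 : ℝ) + k - 1) ≤ engel (tl a) / a 0 :=
    div_le_div₀ (engel_nonneg _) (gk_le_engel ha.tl (by omega)) (by linarith) (by linarith)
  rw [gk_rec ha, engel_rec ha]
  linarith

lemma lt_case0 {a b : ℕ → ℕ} (ha : ok a) (hb : ok b) (hab : a 0 < b 0) :
    |gk 0 a - gk 0 b| ≤ 2 * |engel a - engel b| := by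
  have h0 := ha.geR 0
  have h1 : (a 0 : ℝ) + 1 ≤ b 0 := by exact_mod_cast hab
  rw [abs_of_nonneg (sub_nonneg.2 (lt_gk ha hb hab 0)),
    abs_of_nonneg (sub_nonneg.2 (lt_engel ha hb hab))]
  have hd : 1 / ((b 0 : ℝ) - 1) ≤ 1 / (a 0 : ℝ) :=
    one_div_le_one_div_of_le (by linarith) (by linarith)
  have h2 := defect0 hb
  have h3 : gk (0 + 1) (tl a) / ((a 0 : ℝ) + (0 : ℕ) - 1) ≤ engel (tl a) / ((a 0 : ℝ) / 2) :=
    div_le_div₀ (engel_nonneg _) (gk_le_engel ha.tl (by omega)) (by linarith)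
      (by push_cast; linarith)
  have h4 : engel (tl a) / ((a 0 : ℝ) / 2) = 2 * (engel (tl a) / (a 0 : ℝ)) := by
    have : (a 0 : ℝ) ≠ 0 := by linarith
    field_simp
  rw [gk_rec ha, engel_rec ha]
  simp only [Nat.cast_zero, add_zero] at h3 ⊢
  linarith

lemma eq_gk {a b : ℕ → ℕ} (ha : ok a) (hb : ok b) (hab : a 0 = b 0) (k : ℕ) :
    |gk k a - gk k b| = |gk (k + 1) (tl a) - gk (k + 1) (tl b)| / ((a 0 : ℝ) + k - 1) := by
  have h0 := ha.geR 0
  have hk : (0 : ℝ) ≤ k := by positivity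
  rw [gk_rec ha, gk_rec hb, ← hab, add_sub_add_left_eq_sub, ← sub_div, abs_div,
    abs_of_nonneg (by linarith : 0 ≤ (a 0 : ℝ) + k - 1)]

lemma eq_engel {a b : ℕ → ℕ} (ha : ok a) (hb : ok b) (hab : a 0 = b 0) :
    |engel a - engel b| = |engel (tl a) - engel (tl b)| / (a 0 : ℝ) := by
  rw [engel_rec ha, engel_rec hb, ← hab, add_sub_add_left_eq_sub, ← sub_div, abs_div,
    abs_of_nonneg (by positivity : 0 ≤ (a 0 : ℝ))]

lemma main1 (N : ℕ) : ∀ {a b : ℕ → ℕ} (_ : ok a) (_ : ok b) {k : ℕ} (_ : 1 ≤ k),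
    |gk k a - gk k b| ≤ |engel a - engel b| + 1 * (1 / 2) ^ N := by
  induction N with
  | zero =>
    intro a b ha hb k hk
    have := abs_nonneg (engel a - engel b)
    have : |gk k a - gk k b| ≤ 1 := by
      rw [abs_le]
      constructor <;>
      linarith [gk_le_one ha hk, gk_le_one hb hk, gk_nonneg ha k, gk_nonneg hb k]
    simp only [pow_zero]
    linarith
  | succ N ih =>
    intro a b ha hb k hk
    have hp : (0 : ℝ) ≤ 1 * (1 / 2) ^ (N + 1) := by positivity
    rcases lt_trichotomy (a 0) (b 0) with hab | hab | hab
    · linarith [lt_case ha hb hab hk]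
    · have h0 := ha.geR 0
      have hkR : (1 : ℝ) ≤ k := by exact_mod_cast hk
      have h1 := ih ha.tl hb.tl (k := k + 1) (by omega)
      rw [eq_gk ha hb hab, eq_engel ha hb hab]
      have h2 := div_le_div₀ ((abs_nonneg _).trans h1) h1 (by linarith : (0 : ℝ) < a 0)
        (by linarith : (a 0 : ℝ) ≤ (a 0 : ℝ) + k - 1)
      rw [add_div] at h2
      have h4 : 1 * (1 / 2 : ℝ) ^ N / (a 0 : ℝ) ≤ 1 * (1 / 2 : ℝ) ^ N / 2 :=
        div_le_div_of_nonneg_left (by positivity) (by norm_num) h0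
      rw [pow_succ]
      linarith
    · rw [abs_sub_comm (gk k a), abs_sub_comm (engel a)]
      linarith [lt_case hb ha hab hk]

lemma main0 {a b : ℕ → ℕ} (ha : ok a) (hb : ok b) :
    |gk 0 a - gk 0 b| ≤ 2 * |engel a - engel b| := by
  rcases lt_trichotomy (a 0) (b 0) with hab | hab | hab
  · exact lt_case0 ha hb hab
  · have h0 := ha.geR 0
    have h1 : |gk (0 + 1) (tl a) - gk (0 + 1) (tl b)| ≤ |engel (tl a) - engel (tl b)| :=
      lim_le (fun N => main1 N ha.tl hb.tl (by omega))
    rw [eq_gk ha hb hab, eq_engel ha hb hab]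
    have h2 := div_le_div₀ ((abs_nonneg _).trans h1) h1 (by linarith : (0 : ℝ) < (a 0 : ℝ) / 2)
      (by push_cast; linarith : (a 0 : ℝ) / 2 ≤ (a 0 : ℝ) + (0 : ℕ) - 1)
    refine h2.trans (le_of_eq ?_)
    have : (a 0 : ℝ) ≠ 0 := by linarith
    field_simp
  · rw [abs_sub_comm (gk 0 a), abs_sub_comm (engel a)]
    exact lt_case0 hb ha hab

/-- The map sending the classical Engel expansion with digits `(c_n)` to the
modified Engel expansion with digits `(c_n + n − 1)` is Lipschitz with constant `2`:
`|E'(σ(a)) − E'(σ(b))| ≤ 2·|E(a) − E(b)|` for all nondecreasing digit sequences with first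
term `≥ 2`. -/
theorem engelShift_lipschitz (a b : ℕ → ℕ)
    (ha : Monotone a) (ha2 : 2 ≤ a 0) (hb : Monotone b) (hb2 : 2 ≤ b 0) :
    |modEngel (engelShift a) - modEngel (engelShift b)| ≤ 2 * |engel a - engel b| := by
  exact main0 ⟨ha, ha2⟩ ⟨hb, hb2⟩
end

section
/- (Fractal quasi-equivalence principle for Engel expansions.) Let ψ : ℕ → (0,∞) satisfy ∑_{n=1}^{∞} n/ψ(n) < ∞, and let 𝔐 be a set of nondecreasing integer sequences with first term ≥ 2 such that every a ∈ 𝔐 satisfies a_n ≥ ψ(n) for all sufficiently large n. Then dim_H { E(a) : a ∈ 𝔐 } = dim_H { E'(σ(a)) : a ∈ 𝔐 }, where dim_H denotes the Hausdorff dimension. -/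
open Filter

namespace EngelAux

/-- classical product -/
noncomputable def P (a : ℕ → ℕ) (k : ℕ) : ℝ := ∏ i ∈ Finset.range k, (a i : ℝ)
/-- modified product -/
noncomputable def Q (a : ℕ → ℕ) (k : ℕ) : ℝ := ∏ i ∈ Finset.range k, ((a i : ℝ) + i - 1)
noncomputable def u (a : ℕ → ℕ) (k : ℕ) : ℝ := 1 / (P a k * a k)
noncomputable def w (a : ℕ → ℕ) (k : ℕ) : ℝ := 1 / (Q a k * ((a k : ℝ) + k))
noncomputable def S (a : ℕ → ℕ) (k : ℕ) : ℝ := ∑ i ∈ Finset.range k, u a i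
noncomputable def S' (a : ℕ → ℕ) (k : ℕ) : ℝ := ∑ i ∈ Finset.range k, w a i
noncomputable def T (a : ℕ → ℕ) (k : ℕ) : ℝ := 1 / (P a k * a k * ((a k : ℝ) - 1))
noncomputable def T' (a : ℕ → ℕ) (k : ℕ) : ℝ :=
  1 / (Q a k * ((a k : ℝ) + k - 1) * ((a k : ℝ) + k))

def good (a : ℕ → ℕ) : Prop := Monotone a ∧ 2 ≤ a 0

lemma good.two {a} (h : good a) (k : ℕ) : (2 : ℝ) ≤ a k := by
  have : 2 ≤ a k := h.2.trans (h.1 (Nat.zero_le k))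
  exact_mod_cast this

lemma P_succ (a : ℕ → ℕ) (k : ℕ) : P a (k+1) = P a k * a k := Finset.prod_range_succ _ _
lemma Q_succ (a : ℕ → ℕ) (k : ℕ) : Q a (k+1) = Q a k * ((a k : ℝ) + k - 1) :=
  Finset.prod_range_succ _ _

lemma P_pos {a} (h : good a) (k : ℕ) : 0 < P a k :=
  Finset.prod_pos fun i _ => by linarith [h.two i]
lemma Q_pos {a} (h : good a) (k : ℕ) : 0 < Q a k :=
  Finset.prod_pos fun i _ => by
    have := h.two i
    have : (0:ℝ) ≤ i := Nat.cast_nonneg i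
    linarith

lemma P_le_Q {a} (h : good a) (k : ℕ) : P a k ≤ 2 * Q a k := by
  induction k with
  | zero => simp [P, Q]
  | succ k ih =>
    rcases Nat.eq_zero_or_pos k with rfl | hk
    · have := h.two 0
      simp [P, Q]; linarith
    · rw [P_succ, Q_succ, ← mul_assoc]
      have h1 := h.two k
      have h2 : (1:ℝ) ≤ k := by exact_mod_cast hk
      have := Q_pos h k
      apply mul_le_mul ih <;> linarith

lemma core (C : ℝ) (x y x' y' : ℕ → ℝ) (n : ℕ) (h0 : x n - y n ≤ C * (x' n - y' n))
    (hx : ∀ j, n ≤ j → x (j+1) - x j ≤ C * (x' (j+1) - x' j))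
    (hy : ∀ j, n ≤ j → y j - y (j+1) ≤ C * (y' j - y' (j+1))) (j : ℕ) (hj : n ≤ j) :
    x j - y j ≤ C * (x' j - y' j) := by
  induction j, hj using Nat.le_induction with
  | base => exact h0
  | succ j hj ih => linarith [hx j hj, hy j hj]

/-- the bounds that hold on a piece -/
def bd (N : ℝ) (a : ℕ → ℕ) : Prop := ∀ k : ℕ, Q a k ≤ N * P a k ∧ (k : ℝ) ≤ N * a k

lemma v_eq {a} (h : good a) (j : ℕ) : (S a (j+1) + T a j) - (S a (j+2) + T a (j+1)) =
    ((a (j+1) : ℝ) - a j) / (P a (j+1) * (((a j : ℝ) - 1) * ((a (j+1) : ℝ) - 1))) := by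
  have e1 : S a (j+2) = S a (j+1) + u a (j+1) := Finset.sum_range_succ _ _
  have h1 := h.two j
  have h2 := h.two (j+1)
  have := P_pos h (j+1)
  have h3 : (a j : ℝ) - 1 ≠ 0 := by linarith
  have h4 : (a (j+1) : ℝ) - 1 ≠ 0 := by linarith
  have h5 : (a (j+1) : ℝ) ≠ 0 := by linarith
  rw [e1]; unfold T u; rw [← P_succ]
  field_simp
  ring

lemma v'_eq {a} (h : good a) (j : ℕ) : (S' a (j+1) + T' a j) - (S' a (j+2) + T' a (j+1)) =
    ((a (j+1) : ℝ) - a j) / (Q a (j+1) * (((a j : ℝ) + j) * ((a (j+1) : ℝ) + j))) := by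
  have e1 : S' a (j+2) = S' a (j+1) + w a (j+1) := Finset.sum_range_succ _ _
  have h1 := h.two j
  have h2 := h.two (j+1)
  have := Q_pos h (j+1)
  have hj : (0:ℝ) ≤ j := Nat.cast_nonneg j
  have h3 : (a j : ℝ) + j ≠ 0 := by linarith
  have h4 : (a (j+1) : ℝ) + j ≠ 0 := by linarith
  have h5 : (a (j+1) : ℝ) + (j + 1) ≠ 0 := by linarith
  rw [e1]; unfold T' w; rw [← Q_succ]
  have h6 : (a (j+1) : ℝ) + ((j+1 : ℕ) : ℝ) - 1 = a (j+1) + j := by push_cast; ring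
  rw [h6]; push_cast
  field_simp
  ring

lemma mid_eq {a c} (h : good a) (h' : good c) (n : ℕ) (he : ∀ i < n, a i = c i) :
    S a (n+1) - (S c (n+1) + T c n) =
    ((c n : ℝ) - 1 - a n) / (P a n * ((a n : ℝ) * ((c n : ℝ) - 1))) := by
  have eP : ∀ m ≤ n, P c m = P a m := fun m hm => Finset.prod_congr rfl fun i hi => by
    rw [he i (by have := Finset.mem_range.1 hi; omega)]
  have eS : S c n = S a n := Finset.sum_congr rfl fun i hi => by
    have := Finset.mem_range.1 hi
    simp only [u]; rw [he i this, eP i this.le]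
  have e1 : S a (n+1) = S a n + u a n := Finset.sum_range_succ _ _
  have e2 : S c (n+1) = S c n + u c n := Finset.sum_range_succ _ _
  rw [e1, e2, eS]; unfold T u; rw [eP n le_rfl]
  have h1 := h.two n
  have h2 := h'.two n
  have := P_pos h n
  have h3 : (a n : ℝ) ≠ 0 := by linarith
  have h4 : (c n : ℝ) - 1 ≠ 0 := by linarith
  have h5 : (c n : ℝ) ≠ 0 := by linarith
  field_simp
  ring

lemma mid'_eq {a c} (h : good a) (h' : good c) (n : ℕ) (he : ∀ i < n, a i = c i) :
    S' a (n+1) - (S' c (n+1) + T' c n) =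
    ((c n : ℝ) - 1 - a n) / (Q a n * (((a n : ℝ) + n) * ((c n : ℝ) + n - 1))) := by
  have eP : ∀ m ≤ n, Q c m = Q a m := fun m hm => Finset.prod_congr rfl fun i hi => by
    rw [he i (by have := Finset.mem_range.1 hi; omega)]
  have eS : S' c n = S' a n := Finset.sum_congr rfl fun i hi => by
    have := Finset.mem_range.1 hi
    simp only [w]; rw [he i this, eP i this.le]
  have e1 : S' a (n+1) = S' a n + w a n := Finset.sum_range_succ _ _
  have e2 : S' c (n+1) = S' c n + w c n := Finset.sum_range_succ _ _
  rw [e1, e2, eS]; unfold T' w; rw [eP n le_rfl]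
  have h1 := h.two n
  have h2 := h'.two n
  have := Q_pos h n
  have hj : (0:ℝ) ≤ n := Nat.cast_nonneg n
  have h3 : (a n : ℝ) + n ≠ 0 := by linarith
  have h4 : (c n : ℝ) + n - 1 ≠ 0 := by linarith
  have h5 : (c n : ℝ) + n ≠ 0 := by linarith
  field_simp
  ring

/-- comparison of two fractions with the same numerator -/
lemma frac {d p q C : ℝ} (hd : 0 ≤ d) (hp : 0 < p) (hq : 0 < q) (h : q ≤ C * p) :
    d / p ≤ C * (d / q) := by
  rw [← mul_div_assoc, div_le_div_iff₀ hp hq]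
  nlinarith [mul_le_mul_of_nonneg_left h hd]

/-- forward bounds -/
lemma w_le {a} (h : good a) (k : ℕ) : w a k ≤ 2 * u a k := by
  have h1 := h.two k
  have hk : (0:ℝ) ≤ k := Nat.cast_nonneg k
  have hP := P_pos h k
  have hQ := Q_pos h k
  refine frac zero_le_one (by positivity) (by positivity) ?_
  rw [← mul_assoc]
  exact mul_le_mul (P_le_Q h k) (by linarith) (by linarith) (by linarith)

lemma T'_le {a} (h : good a) (k : ℕ) : T' a k ≤ 2 * T a k := by
  have h1 := h.two k
  have hk : (0:ℝ) ≤ k := Nat.cast_nonneg k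
  unfold T T'
  rw [← P_succ, ← Q_succ]
  have hP := P_pos h (k+1)
  have hQ := Q_pos h (k+1)
  refine frac zero_le_one (by positivity) (mul_pos hP (by linarith)) ?_
  rw [← mul_assoc]
  exact mul_le_mul (P_le_Q h _) (by linarith) (by linarith) (by linarith)

lemma prod3 {A B p q r s : ℝ} (c1 c2 c3 : ℝ) (hA : A ≤ c1 * B) (hp : p ≤ c2 * q) (hr : r ≤ c3 * s)
    (A0 : 0 ≤ A) (p0 : 0 ≤ p) (r0 : 0 ≤ r) : A * (p * r) ≤ (c1 * c2 * c3) * (B * (q * s)) := by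
  calc A * (p * r) ≤ (c1 * B) * ((c2 * q) * (c3 * s)) := by
        apply mul_le_mul hA (mul_le_mul hp hr r0 (p0.trans hp)) (mul_nonneg p0 r0) (A0.trans hA)
    _ = _ := by ring

lemma u_le {a N} (h : good a) (hb : bd N a) (hN : 1 ≤ N) (k : ℕ) :
    u a k ≤ (4 * N * (1+N)^2) * w a k := by
  have h1 := h.two k
  have hk : (0:ℝ) ≤ k := Nat.cast_nonneg k
  have hP := P_pos h k
  have hQ := Q_pos h k
  refine frac zero_le_one (by positivity) (by positivity) ?_
  have := prod3 (p := (a k : ℝ) + k) (q := a k) (r := 1) (s := 1) N (1+N) (4*(1+N)) (hb k).1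
    (by linarith [(hb k).2]) (by linarith) hQ.le (by linarith) (by linarith)
  simp only [mul_one] at this
  refine this.trans (le_of_eq (by ring))

lemma T_le {a N} (h : good a) (hb : bd N a) (hN : 1 ≤ N) (k : ℕ) :
    T a k ≤ (4 * N * (1+N)^2) * T' a k := by
  have h1 := h.two k
  have hk : (0:ℝ) ≤ k := Nat.cast_nonneg k
  unfold T T'
  rw [← P_succ, ← Q_succ]
  have hP := P_pos h (k+1)
  have hQ := Q_pos h (k+1)
  refine frac zero_le_one (mul_pos hP (by linarith)) (by positivity) ?_
  have := prod3 (p := (a k : ℝ) + k) (q := a k - 1) (r := 1) (s := 1) N (2*(1+N)) (2*(1+N))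
    (hb (k+1)).1 (by nlinarith [(hb k).2]) (by linarith) hQ.le (by linarith) (by linarith)
  simp only [mul_one] at this
  refine this.trans (le_of_eq (by ring))

lemma S_succ (a : ℕ → ℕ) (k : ℕ) : S a (k+1) = S a k + u a k := Finset.sum_range_succ _ _
lemma S'_succ (a : ℕ → ℕ) (k : ℕ) : S' a (k+1) = S' a k + w a k := Finset.sum_range_succ _ _

lemma u_nonneg {a} (h : good a) (k : ℕ) : 0 ≤ u a k := by
  have := P_pos h k
  unfold u; positivity
lemma w_nonneg {a} (h : good a) (k : ℕ) : 0 ≤ w a k := by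
  have := Q_pos h k
  unfold w; positivity
lemma T_nonneg {a} (h : good a) (k : ℕ) : 0 ≤ T a k := by
  have := P_pos h k
  have : 0 ≤ (a k : ℝ) - 1 := by linarith [h.two k]
  unfold T; positivity
lemma T'_nonneg {a} (h : good a) (k : ℕ) : 0 ≤ T' a k := by
  have := Q_pos h k
  have : 0 ≤ (a k : ℝ) + k - 1 := by
    have hk : (0:ℝ) ≤ k := Nat.cast_nonneg k
    linarith [h.two k]
  unfold T'; positivity

lemma step {a} (h : good a) (j : ℕ) : (0:ℝ) ≤ (a (j+1) : ℝ) - a j := by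
  have : a j ≤ a (j+1) := h.1 (Nat.le_succ j)
  have : (a j : ℝ) ≤ a (j+1) := by exact_mod_cast this
  linarith

section pair
variable {a c : ℕ → ℕ}

lemma nonneg (h : good a) (h' : good c) (n : ℕ) (he : ∀ i < n, a i = c i)
    (hlt : a n < c n) (j : ℕ) (hj : n ≤ j) : 0 ≤ S a (j+1) - S c (j+1) := by
  have hlt' : (a n : ℝ) + 1 ≤ c n := by exact_mod_cast hlt
  have key := core 1 (fun _ => 0) (fun _ => 0) (fun j => S a (j+1)) (fun j => S c (j+1) + T c j) n
    (by
      rw [mid_eq h h' n he]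
      have := P_pos h n
      have h2 := h'.two n
      have : 0 ≤ (c n : ℝ) - 1 := by linarith
      have : 0 ≤ (c n : ℝ) - 1 - a n := by linarith
      rw [one_mul, sub_zero]; positivity)
    (by intro j _; simp only [S_succ a (j+1)]; linarith [u_nonneg h (j+1)])
    (by
      intro j _; rw [v_eq h' j]
      have := P_pos h' (j+1)
      have h2 := h'.two j
      have h3 := h'.two (j+1)
      have : 0 ≤ (c j : ℝ) - 1 := by linarith
      have : 0 ≤ (c (j+1) : ℝ) - 1 := by linarith
      have := step h' j
      rw [one_mul, sub_zero]; positivity) j hj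
  linarith [T_nonneg h' j]

lemma nonneg' (h : good a) (h' : good c) (n : ℕ) (he : ∀ i < n, a i = c i)
    (hlt : a n < c n) (j : ℕ) (hj : n ≤ j) : 0 ≤ S' a (j+1) - S' c (j+1) := by
  have hlt' : (a n : ℝ) + 1 ≤ c n := by exact_mod_cast hlt
  have key := core 1 (fun _ => 0) (fun _ => 0) (fun j => S' a (j+1)) (fun j => S' c (j+1) + T' c j) n
    (by
      rw [mid'_eq h h' n he]
      have := Q_pos h n
      have h2 := h'.two n
      have hk : (0:ℝ) ≤ n := Nat.cast_nonneg n
      have : 0 ≤ (c n : ℝ) + n - 1 := by linarith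
      have : 0 ≤ (c n : ℝ) - 1 - a n := by linarith
      rw [one_mul, sub_zero]; positivity)
    (by intro j _; simp only [S'_succ a (j+1)]; linarith [w_nonneg h (j+1)])
    (by
      intro j _; rw [v'_eq h' j]
      have := Q_pos h' (j+1)
      have := step h' j
      rw [one_mul, sub_zero]; positivity) j hj
  linarith [T'_nonneg h' j]

lemma fwd (h : good a) (h' : good c) (n : ℕ) (he : ∀ i < n, a i = c i)
    (hlt : a n < c n) (j : ℕ) (hj : n ≤ j) :
    S' a (j+1) - S' c (j+1) ≤ 2 * (S a (j+1) - S c (j+1)) := by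
  have hlt' : (a n : ℝ) + 1 ≤ c n := by exact_mod_cast hlt
  have key := core 2 (fun j => S' a (j+1)) (fun j => S' c (j+1) + T' c j)
    (fun j => S a (j+1)) (fun j => S c (j+1) + T c j) n
    (by
      rw [mid_eq h h' n he, mid'_eq h h' n he]
      have hP := P_pos h n
      have hQ := Q_pos h n
      have h2 := h'.two n
      have h1 := h.two n
      have hk : (0:ℝ) ≤ n := Nat.cast_nonneg n
      have t1 : 0 < (c n : ℝ) + n - 1 := by linarith
      have t2 : 0 < (c n : ℝ) - 1 := by linarith
      refine frac (by linarith) (by positivity) (by positivity) ?_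
      have := prod3 2 1 1 (P_le_Q h n) (p := a n) (q := a n + n) (r := c n - 1) (s := c n + n - 1)
        (by linarith) (by linarith) hP.le (by linarith) (by linarith)
      linarith)
    (by intro j _; simp only [S'_succ a (j+1), S_succ a (j+1)]; linarith [w_le h (j+1)])
    (by
      intro j _; rw [v_eq h' j, v'_eq h' j]
      have hP := P_pos h' (j+1)
      have hQ := Q_pos h' (j+1)
      have h2 := h'.two j
      have h3 := h'.two (j+1)
      have hk : (0:ℝ) ≤ j := Nat.cast_nonneg j
      have t1 : 0 < (c j : ℝ) - 1 := by linarith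
      have t2 : 0 < (c (j+1) : ℝ) - 1 := by linarith
      refine frac (step h' j) (by positivity) (by positivity) ?_
      have := prod3 2 1 1 (P_le_Q h' (j+1)) (p := c j - 1) (q := c j + j) (r := c (j+1) - 1)
        (s := c (j+1) + j)
        (by linarith) (by linarith) hP.le (by linarith) (by linarith)
      linarith) j hj
  linarith [T'_le h' j]

lemma bwd {N : ℝ} (hN : 1 ≤ N) (h : good a) (h' : good c) (hb : bd N a) (hb' : bd N c)
    (n : ℕ) (he : ∀ i < n, a i = c i) (hlt : a n < c n) (j : ℕ) (hj : n ≤ j) :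
    S a (j+1) - S c (j+1) ≤ (4 * N * (1+N)^2) * (S' a (j+1) - S' c (j+1)) := by
  have hlt' : (a n : ℝ) + 1 ≤ c n := by exact_mod_cast hlt
  have key := core (4 * N * (1+N)^2) (fun j => S a (j+1)) (fun j => S c (j+1) + T c j)
    (fun j => S' a (j+1)) (fun j => S' c (j+1) + T' c j) n
    (by
      rw [mid_eq h h' n he, mid'_eq h h' n he]
      have hP := P_pos h n
      have hQ := Q_pos h n
      have h2 := h'.two n
      have h1 := h.two n
      have hk : (0:ℝ) ≤ n := Nat.cast_nonneg n
      have t1 : 0 < (c n : ℝ) + n - 1 := by linarith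
      have t2 : 0 < (c n : ℝ) - 1 := by linarith
      refine frac (by linarith) (by positivity) (by positivity) ?_
      have := prod3 N (2*(1+N)) (2*(1+N)) (hb n).1 (p := a n + n) (q := a n)
        (r := c n + n - 1) (s := c n - 1)
        (by nlinarith [(hb n).2]) (by nlinarith [(hb' n).2]) hQ.le (by linarith) (by linarith)
      refine this.trans (le_of_eq (by ring)))
    (by intro j _; simp only [S'_succ a (j+1), S_succ a (j+1)]; linarith [u_le h hb hN (j+1)])
    (by
      intro j _; rw [v_eq h' j, v'_eq h' j]
      have hP := P_pos h' (j+1)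
      have hQ := Q_pos h' (j+1)
      have h2 := h'.two j
      have h3 := h'.two (j+1)
      have hk : (0:ℝ) ≤ j := Nat.cast_nonneg j
      have t1 : 0 < (c j : ℝ) - 1 := by linarith
      have t2 : 0 < (c (j+1) : ℝ) - 1 := by linarith
      have b1 := (hb' (j+1)).2
      push_cast at b1
      refine frac (step h' j) (by positivity) (by positivity) ?_
      have := prod3 N (2*(1+N)) (2*(1+N)) (hb' (j+1)).1 (p := c j + j) (q := c j - 1)
        (r := c (j+1) + j) (s := c (j+1) - 1)
        (by nlinarith [(hb' j).2]) (by nlinarith) hQ.le (by linarith) (by linarith)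
      refine this.trans (le_of_eq (by ring))) j hj
  linarith [T_le h' hb' hN j]
end pair

lemma summable_u {a} (h : good a) : Summable (u a) := by
  refine Summable.of_nonneg_of_le (u_nonneg h) (f := fun k => (1/2:ℝ)^(k+1)) (fun k => ?_)
    ((summable_nat_add_iff 1).2 summable_geometric_two)
  unfold u
  rw [← P_succ, one_div_pow]
  refine one_div_le_one_div_of_le (by positivity) ?_
  have := Finset.prod_le_prod (s := Finset.range (k+1)) (f := fun _ => (2:ℝ))
    (g := fun i => (a i : ℝ)) (fun _ _ => by norm_num) (fun i _ => h.two i)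
  simpa [P] using this

lemma summable_w {a} (h : good a) : Summable (w a) :=
  Summable.of_nonneg_of_le (w_nonneg h) (w_le h) ((summable_u h).mul_left 2)

lemma engel_eq (a) : engel a = ∑' n, u a n := by
  unfold engel u
  simp only [← P_succ]; rfl

lemma modEngel_eq {a} (h : good a) : modEngel (engelShift a) = ∑' n, w a n := by
  rw [(summable_w h).tsum_eq_zero_add]
  unfold modEngel engelShift w Q
  simp

lemma tendsto_S {a} (h : good a) : Tendsto (fun j => S a (j+1)) atTop (nhds (engel a)) := by
  rw [engel_eq]
  exact (tendsto_add_atTop_iff_nat 1).2 (summable_u h).hasSum.tendsto_sum_nat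

lemma tendsto_S' {a} (h : good a) :
    Tendsto (fun j => S' a (j+1)) atTop (nhds (modEngel (engelShift a))) := by
  rw [modEngel_eq h]
  exact (tendsto_add_atTop_iff_nat 1).2 (summable_w h).hasSum.tendsto_sum_nat

lemma first_diff {a c : ℕ → ℕ} (hne : a ≠ c) : ∃ n, (∀ i < n, a i = c i) ∧ a n ≠ c n := by
  classical
  have hex : ∃ n, a n ≠ c n := Function.ne_iff.1 hne
  exact ⟨Nat.find hex, fun i hi => not_not.1 (Nat.find_min hex hi), Nat.find_spec hex⟩

lemma dist_fwd {a c} (h : good a) (h' : good c) :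
    |modEngel (engelShift a) - modEngel (engelShift c)| ≤ 2 * |engel a - engel c| := by
  by_cases hne : a = c
  · simp [hne]
  obtain ⟨n, he, hn⟩ := first_diff hne
  have main : ∀ {a c : ℕ → ℕ}, good a → good c → (∀ i < n, a i = c i) → a n < c n →
      |modEngel (engelShift a) - modEngel (engelShift c)| ≤ 2 * |engel a - engel c| := by
    intro a c h h' he hlt
    refine le_of_tendsto_of_tendsto ((tendsto_S' h).sub (tendsto_S' h')).abs
      (((tendsto_S h).sub (tendsto_S h')).abs.const_mul 2) ?_
    filter_upwards [eventually_ge_atTop n] with j hj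
    rw [abs_of_nonneg (nonneg h h' n he hlt j hj), abs_of_nonneg (nonneg' h h' n he hlt j hj)]
    exact fwd h h' n he hlt j hj
  rcases lt_or_gt_of_ne hn with hlt | hlt
  · exact main h h' he hlt
  · rw [abs_sub_comm, abs_sub_comm (engel a)]
    exact main h' h (fun i hi => (he i hi).symm) hlt

lemma dist_bwd {a c} {N : ℝ} (hN : 1 ≤ N) (h : good a) (h' : good c) (hb : bd N a) (hb' : bd N c) :
    |engel a - engel c| ≤
      (4 * N * (1+N)^2) * |modEngel (engelShift a) - modEngel (engelShift c)| := by
  by_cases hne : a = c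
  · simp [hne]
  obtain ⟨n, he, hn⟩ := first_diff hne
  have main : ∀ {a c : ℕ → ℕ}, good a → good c → bd N a → bd N c → (∀ i < n, a i = c i) →
      a n < c n → |engel a - engel c| ≤
      (4 * N * (1+N)^2) * |modEngel (engelShift a) - modEngel (engelShift c)| := by
    intro a c h h' hb hb' he hlt
    refine le_of_tendsto_of_tendsto ((tendsto_S h).sub (tendsto_S h')).abs
      (((tendsto_S' h).sub (tendsto_S' h')).abs.const_mul _) ?_
    filter_upwards [eventually_ge_atTop n] with j hj
    rw [abs_of_nonneg (nonneg h h' n he hlt j hj), abs_of_nonneg (nonneg' h h' n he hlt j hj)]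
    exact bwd hN h h' hb hb' n he hlt j hj
  rcases lt_or_gt_of_ne hn with hlt | hlt
  · exact main h h' hb hb' he hlt
  · rw [abs_sub_comm, abs_sub_comm (modEngel _)]
    exact main h' h hb' hb (fun i hi => (he i hi).symm) hlt

lemma dim_le {A : Type*} (M : Set A) (F G : A → ℝ) (C : ℝ) (hC : 0 ≤ C)
    (hFG : ∀ a ∈ M, ∀ c ∈ M, |F a - F c| ≤ C * |G a - G c|) : dimH (F '' M) ≤ dimH (G '' M) := by
  classical
  rcases M.eq_empty_or_nonempty with rfl | ⟨a0, _⟩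
  · simp
  have : Nonempty A := ⟨a0⟩
  let g : ℝ → ℝ := F ∘ Function.invFunOn G M
  have hg : ∀ a ∈ M, g (G a) = F a := by
    intro a ha
    have hex : ∃ c ∈ M, G c = G a := ⟨a, ha, rfl⟩
    have h1 := Function.invFunOn_mem hex
    have h2 := Function.invFunOn_eq hex
    have := hFG _ h1 _ ha
    rw [h2] at this
    simp only [sub_self, abs_zero, mul_zero] at this
    exact sub_eq_zero.1 (abs_nonpos_iff.1 this)
  have hl : LipschitzOnWith C.toNNReal g (G '' M) := by
    refine LipschitzOnWith.of_dist_le_mul ?_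
    rintro _ ⟨a, ha, rfl⟩ _ ⟨c, hc, rfl⟩
    rw [hg a ha, hg c hc, Real.dist_eq, Real.dist_eq, Real.coe_toNNReal _ hC]
    exact hFG a ha c hc
  have : F '' M = g '' (G '' M) := by
    rw [Set.image_image]
    exact Set.image_congr fun a ha => (hg a ha).symm
  rw [this]
  exact hl.dimH_image_le

lemma exists_bd {a} (h : good a) (ψ : ℕ → ℝ) (hψpos : ∀ n, 0 < ψ n)
    (hψsum : Summable fun n : ℕ => (n : ℝ) / ψ n) (hev : ∀ᶠ n in atTop, ψ n ≤ (a n : ℝ)) :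
    ∃ N : ℕ, bd ((N : ℝ) + 1) a := by
  have hs : Summable fun n : ℕ => (n : ℝ) / a n := by
    refine Summable.of_norm_bounded_eventually_nat hψsum ?_
    filter_upwards [hev] with n hn
    rw [Real.norm_of_nonneg (by positivity)]
    exact div_le_div_of_nonneg_left (by positivity) (hψpos n) hn
  have hnn : ∀ n : ℕ, 0 ≤ (n : ℝ) / a n := fun n => by positivity
  obtain ⟨N, hN⟩ := exists_nat_ge (Real.exp (∑' n : ℕ, (n : ℝ) / a n))
  refine ⟨N, fun k => ⟨?_, ?_⟩⟩
  · have h1 : Q a k ≤ P a k * ∏ i ∈ Finset.range k, Real.exp ((i : ℝ) / a i) := by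
      unfold P Q
      rw [← Finset.prod_mul_distrib]
      refine Finset.prod_le_prod (fun i _ => ?_) (fun i _ => ?_)
      · have := h.two i
        have hk : (0:ℝ) ≤ i := Nat.cast_nonneg i
        linarith
      · have h2 := h.two i
        have h3 := Real.add_one_le_exp ((i:ℝ) / a i)
        have h4 : (a i : ℝ) * ((i:ℝ) / a i + 1) = a i + i := by
          have : (a i : ℝ) ≠ 0 := by linarith
          field_simp
          ring
        have := mul_le_mul_of_nonneg_left h3 (show (0:ℝ) ≤ a i by linarith)
        linarith
    rw [← Real.exp_sum] at h1
    have h2 := Real.exp_le_exp.2 (hs.sum_le_tsum (Finset.range k) (fun i _ => hnn i))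
    have := mul_le_mul_of_nonneg_left (h2.trans hN) (P_pos h k).le
    nlinarith [P_pos h k]
  · have h1 := hs.le_tsum k (fun i _ => hnn i)
    have h2 := Real.add_one_le_exp (∑' n : ℕ, (n : ℝ) / a n)
    have h3 := h.two k
    have : (k : ℝ) / a k ≤ N + 1 := by linarith
    rwa [div_le_iff₀ (by linarith)] at this

end EngelAux



/-- Fractal quasi-equivalence principle for Engel expansions: if
`∑ n/ψ(n) < ∞` and every `a ∈ 𝔐` is nondecreasing with `a₁ ≥ 2` and `a_n ≥ ψ(n)` for all
sufficiently large `n`, then `dim_H {E(a) : a ∈ 𝔐} = dim_H {E'(σ(a)) : a ∈ 𝔐}`. -/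
theorem fractal_quasi_equivalence_engel (ψ : ℕ → ℝ) (hψpos : ∀ n, 0 < ψ n)
    (hψsum : Summable fun n : ℕ => (n : ℝ) / ψ n)
    (𝔐 : Set (ℕ → ℕ))
    (h𝔐 : ∀ a ∈ 𝔐, Monotone a ∧ 2 ≤ a 0 ∧ ∀ᶠ n in atTop, ψ n ≤ (a n : ℝ)) :
    dimH {x : ℝ | ∃ a ∈ 𝔐, x = engel a} =
      dimH {x : ℝ | ∃ a ∈ 𝔐, x = modEngel (engelShift a)} := by
  have hgood : ∀ a ∈ 𝔐, EngelAux.good a := fun a ha => ⟨(h𝔐 a ha).1, (h𝔐 a ha).2.1⟩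
  have e1 : {x : ℝ | ∃ a ∈ 𝔐, x = engel a} = engel '' 𝔐 := by
    ext x; simp [eq_comm]
  have e2 : {x : ℝ | ∃ a ∈ 𝔐, x = modEngel (engelShift a)} =
      (fun a => modEngel (engelShift a)) '' 𝔐 := by
    ext x; simp [eq_comm]
  rw [e1, e2]
  apply le_antisymm
  · have hU : 𝔐 = ⋃ N : ℕ, {a ∈ 𝔐 | EngelAux.bd ((N : ℝ) + 1) a} := by
      ext a
      simp only [Set.mem_iUnion, Set.mem_ofPred_eq, exists_and_left]
      exact ⟨fun ha => ⟨ha, EngelAux.exists_bd (hgood a ha) ψ hψpos hψsum (h𝔐 a ha).2.2⟩,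
        fun ha => ha.1⟩
    have hI : engel '' 𝔐 = ⋃ N : ℕ, engel '' {a ∈ 𝔐 | EngelAux.bd ((N : ℝ) + 1) a} := by
      conv_lhs => rw [hU]
      rw [Set.image_iUnion]
    rw [hI, dimH_iUnion]
    refine iSup_le fun N => ?_
    have hN : (1:ℝ) ≤ (N : ℝ) + 1 := by
      have : (0:ℝ) ≤ N := Nat.cast_nonneg N
      linarith
    refine (EngelAux.dim_le _ engel (fun a => modEngel (engelShift a))
      (4 * ((N:ℝ)+1) * (1+((N:ℝ)+1))^2) (by positivity) ?_).trans
      (dimH_mono (Set.image_mono fun a ha => ha.1))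
    intro a ha c hc
    exact EngelAux.dist_bwd hN (hgood a ha.1) (hgood c hc.1) ha.2 hc.2
  · exact EngelAux.dim_le _ _ _ 2 (by norm_num)
      fun a ha c hc => EngelAux.dist_fwd (hgood a ha) (hgood c hc)
end

section
/- The set of numbers whose Pierce expansion digits (in traditional notation) d_n satisfy lim_{n→∞} (log d_{n+1})/(log d_n) = ∞ has Hausdorff dimension 0; that is, dim_H { Π̃(d) : d = (d_n)_{n≥1} a strictly increasing sequence of positive integers with lim_{n→∞} (log d_{n+1})/(log d_n) = ∞ } = 0. -/
open Filter

def pierceOk (d : ℕ → ℕ) : Prop := StrictMono d ∧ ∀ n, 0 < d n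

lemma pierceOk.shift {d : ℕ → ℕ} (h : pierceOk d) (k : ℕ) : pierceOk (fun n => d (n + k)) :=
  ⟨fun a b hab => h.1 (by omega), fun n => h.2 _⟩

lemma pierceOk.prod_ge {d : ℕ → ℕ} (h : pierceOk d) (n : ℕ) :
    ((n.factorial : ℕ) : ℝ) ≤ ∏ i ∈ Finset.range n, (d i : ℝ) := by
  have hd : ∀ n, n + 1 ≤ d n := by
    intro n
    induction n with
    | zero => exact h.2 0
    | succ k ih => have := h.1 (Nat.lt_succ_self k); simp only [Nat.succ_eq_add_one] at this; omega
  induction n with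
  | zero => simp
  | succ k ih =>
    rw [Finset.prod_range_succ, Nat.factorial_succ]
    push_cast
    rw [mul_comm]
    have := hd k
    have h2 : ((k : ℝ) + 1) ≤ d k := by exact_mod_cast this
    gcongr

lemma pierceOk.term_le {d : ℕ → ℕ} (h : pierceOk d) (n : ℕ) :
    ‖(-1 : ℝ) ^ n / ∏ i ∈ Finset.range (n + 1), (d i : ℝ)‖ ≤ 1 / (((n + 1).factorial : ℕ) : ℝ) := by
  have h1 := h.prod_ge (n + 1)
  have h0 : (0 : ℝ) < (((n + 1).factorial : ℕ) : ℝ) := by exact_mod_cast Nat.factorial_pos _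
  rw [norm_div, norm_pow, norm_neg, norm_one, one_pow, Real.norm_of_nonneg (by linarith)]
  exact one_div_le_one_div_of_le h0 h1

lemma summable_fact_shift : Summable (fun n : ℕ => 1 / (((n + 1).factorial : ℕ) : ℝ)) := by
  have h := Real.summable_pow_div_factorial 1
  simp only [one_pow] at h
  exact (summable_nat_add_iff 1).2 h

lemma pierceOk.summable {d : ℕ → ℕ} (h : pierceOk d) :
    Summable (fun n : ℕ => (-1 : ℝ) ^ n / ∏ i ∈ Finset.range (n + 1), (d i : ℝ)) :=
  Summable.of_norm_bounded summable_fact_shift h.term_le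

noncomputable def pierceC : ℝ := ∑' n : ℕ, 1 / (((n + 1).factorial : ℕ) : ℝ)

lemma pierceC_nonneg : 0 ≤ pierceC := tsum_nonneg fun n => by positivity

lemma pierceOk.abs_le {d : ℕ → ℕ} (h : pierceOk d) : |pierceTrad d| ≤ pierceC :=
  tsum_of_norm_bounded summable_fact_shift.hasSum h.term_le

lemma pierceOk.rec {d : ℕ → ℕ} (h : pierceOk d) :
    pierceTrad d = (1 / (d 0 : ℝ)) * (1 - pierceTrad (fun n => d (n + 1))) := by
  have h1 : pierceTrad d = _ := h.summable.tsum_eq_zero_add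
  rw [h1]
  have h2 : ∀ n : ℕ, (-1 : ℝ) ^ (n + 1) / ∏ i ∈ Finset.range (n + 1 + 1), (d i : ℝ)
      = (-(1 / (d 0 : ℝ))) * ((-1 : ℝ) ^ n / ∏ i ∈ Finset.range (n + 1), (d (i + 1) : ℝ)) := by
    intro n
    rw [Finset.prod_range_succ' _ (n + 1), pow_succ, neg_mul, div_mul_div_comm, ← neg_div]
    rw [mul_comm (d 0 : ℝ)]
    congr 1
    ring
  simp_rw [h2]
  rw [tsum_mul_left]
  simp [pierceTrad]
  ring

lemma pierceOk.abs_le' {d : ℕ → ℕ} (h : pierceOk d) :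
    |pierceTrad d| ≤ (1 + pierceC) / (d 0 : ℝ) := by
  rw [h.rec, abs_mul, abs_of_nonneg (by positivity : (0 : ℝ) ≤ 1 / (d 0 : ℝ)),
    div_mul_eq_mul_div, one_mul]
  have h2 := (h.shift 1).abs_le
  gcongr
  have := abs_sub (1 : ℝ) (pierceTrad (fun n => d (n + 1)))
  rw [abs_one] at this
  linarith

lemma pierceOk.sub_eq {d e : ℕ → ℕ} (hd : pierceOk d) (he : pierceOk e) (n : ℕ)
    (h : ∀ i < n, d i = e i) :
    |pierceTrad d - pierceTrad e| = (1 / ∏ i ∈ Finset.range n, (d i : ℝ)) *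
      |pierceTrad (fun i => d (i + n)) - pierceTrad (fun i => e (i + n))| := by
  induction n with
  | zero => simp
  | succ k ih =>
    rw [ih (fun i hi => h i (by omega)), (hd.shift k).rec, (he.shift k).rec]
    simp only [Nat.zero_add, ← h k (by omega)]
    rw [← mul_sub, abs_mul, abs_of_nonneg (by positivity : (0 : ℝ) ≤ 1 / (d k : ℝ)), ← mul_assoc,
      Finset.prod_range_succ, div_mul_div_comm, one_mul]
    congr 1
    rw [sub_sub_sub_cancel_left, abs_sub_comm]
    simp only [add_assoc, add_comm 1 k]

def pierceF (L N : ℕ) : Set ℝ := {x | ∃ d : ℕ → ℕ, pierceOk d ∧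
  (∀ n, N ≤ n → 2 ≤ d n ∧ d n ^ (2 * L) ≤ d (n + 1)) ∧ x = pierceTrad d}

lemma dimH_pierceF_le (L N : ℕ) : dimH (pierceF L N) ≤ dimH (pierceF L 0) := by
  induction N with
  | zero => exact le_rfl
  | succ k ih =>
    have hsub : pierceF L (k + 1) ⊆
        ⋃ m : ℕ, (fun x : ℝ => (1 / ((m : ℝ) + 1)) * (1 - x)) '' pierceF L k := by
      rintro x ⟨d, hd, h, rfl⟩
      refine Set.mem_iUnion.2 ⟨d 0 - 1, pierceTrad (fun n => d (n + 1)),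
        ⟨_, hd.shift 1, fun n hn => h (n + 1) (by omega), rfl⟩, ?_⟩
      have h0 : ((d 0 - 1 : ℕ) : ℝ) + 1 = d 0 := by
        have := hd.2 0
        rw [Nat.cast_sub this]; simp
      simp only [h0]
      exact hd.rec.symm
    refine (dimH_mono hsub).trans ?_
    rw [dimH_iUnion]
    refine iSup_le fun m => le_trans ?_ ih
    have hl : LipschitzWith 1 (fun x : ℝ => (1 / ((m : ℝ) + 1)) * (1 - x)) := by
      refine LipschitzWith.of_dist_le_mul fun x y => ?_
      rw [Real.dist_eq, Real.dist_eq, ← mul_sub, abs_mul, sub_sub_sub_cancel_left, abs_sub_comm y x]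
      gcongr
      rw [abs_of_nonneg (by positivity)]
      simp only [NNReal.coe_one]
      rw [div_le_one (by positivity)]
      have : (0 : ℝ) ≤ m := by positivity
      linarith
    exact hl.dimH_image_le _

open scoped ENNReal in
lemma tsum_fin_prod (w : ℕ → ℝ≥0∞) (n : ℕ) :
    ∑' f : Fin n → ℕ, ∏ i, w (f i) = (∑' m, w m) ^ n := by
  induction n with
  | zero => simp
  | succ k ih =>
    rw [← (Fin.consEquiv (fun _ : Fin (k + 1) => ℕ)).tsum_eq, ENNReal.tsum_prod']
    simp only [Fin.consEquiv_apply, Fin.prod_univ_succ, Fin.cons_zero, Fin.cons_succ]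
    simp_rw [ENNReal.tsum_mul_left, ih, ENNReal.tsum_mul_right]
    rw [pow_succ']

noncomputable def pierceW (m : ℕ) : ENNReal := if 2 ≤ m then ENNReal.ofReal ((1 / (m : ℝ)) ^ 2) else 0

lemma tsum_pierceW : ∑' m, pierceW m ≤ 1 := by
  have h := hasSum_zeta_two
  have h2 : HasSum (fun n : ℕ => 1 / ((n + 2 : ℕ) : ℝ) ^ 2) (Real.pi ^ 2 / 6 - 1) := by
    have := (hasSum_nat_add_iff' 2).2 h
    simpa [Finset.sum_range_succ] using this
  have h3 : ∑' m, pierceW m = ∑' m, pierceW (m + 2) := by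
    rw [← ENNReal.summable.sum_add_tsum_nat_add' (k := 2)]
    simp [Finset.sum_range_succ, pierceW]
  rw [h3]
  have h4 : ∀ m, pierceW (m + 2) = ENNReal.ofReal (1 / ((m + 2 : ℕ) : ℝ) ^ 2) := by
    intro m
    simp [pierceW]
  simp_rw [h4]
  rw [← ENNReal.ofReal_tsum_of_nonneg (fun n => by positivity) h2.summable, h2.tsum_eq,
    ENNReal.ofReal_le_one]
  nlinarith [Real.pi_lt_d2, Real.pi_pos]

lemma prod_le_sq {d : ℕ → ℕ} {L : ℕ} (hL : 1 ≤ L)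
    (h : ∀ n, 2 ≤ d n ∧ d n ^ (2 * L) ≤ d (n + 1)) (n : ℕ) :
    ∏ i ∈ Finset.range (n + 1), d i ≤ d n ^ 2 := by
  induction n with
  | zero => have := (h 0).1; simp; nlinarith
  | succ k ih =>
    rw [Finset.prod_range_succ, sq]
    have h1 : d k ^ 2 ≤ d k ^ (2 * L) := Nat.pow_le_pow_right (by have := (h k).1; omega) (by omega)
    exact Nat.mul_le_mul_right _ (ih.trans (h1.trans (h k).2))

def pierceCyl (L n : ℕ) (f : Fin (n + 1) → ℕ) : Set ℝ := {x | ∃ d : ℕ → ℕ, pierceOk d ∧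
  (∀ n, 2 ≤ d n ∧ d n ^ (2 * L) ≤ d (n + 1)) ∧ (∀ i : Fin (n + 1), d i = f i) ∧ x = pierceTrad d}

lemma ediam_cyl {L : ℕ} (hL : 1 ≤ L) (n : ℕ) (f : Fin (n + 1) → ℕ) :
    Metric.ediam (pierceCyl L n f) ≤
      ENNReal.ofReal ((2 * (1 + pierceC)) * (1 / ∏ i, (f i : ℝ)) ^ L) := by
  refine Metric.ediam_le ?_
  rintro x ⟨d, hd, h, hf, rfl⟩ y ⟨e, he, h', hf', rfl⟩
  rw [edist_dist, Real.dist_eq]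
  refine ENNReal.ofReal_le_ofReal ?_
  have hC := pierceC_nonneg
  have hag : ∀ i < n + 1, d i = e i := fun i hi => (hf ⟨i, hi⟩).trans (hf' ⟨i, hi⟩).symm
  rw [hd.sub_eq he (n + 1) hag]
  have key : ∀ d : ℕ → ℕ, pierceOk d → (∀ n, 2 ≤ d n ∧ d n ^ (2 * L) ≤ d (n + 1)) →
      (∀ i : Fin (n + 1), d i = f i) → |pierceTrad (fun i => d (i + (n + 1)))| ≤
        (1 + pierceC) * (1 / ∏ i, (f i : ℝ)) ^ L := by
    intro d hd h hf
    refine (hd.shift (n + 1)).abs_le'.trans ?_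
    rw [one_div, inv_pow, ← div_eq_mul_inv]
    have hp : ∏ i, (f i : ℝ) = ((∏ i ∈ Finset.range (n + 1), d i : ℕ) : ℝ) := by
      rw [Finset.prod_range]; push_cast; simp [hf]
    have hpos : 0 < ∏ i ∈ Finset.range (n + 1), d i := Finset.prod_pos fun i _ => hd.2 i
    rw [hp]
    have h2 : (∏ i ∈ Finset.range (n + 1), d i) ^ L ≤ d (0 + (n + 1)) := by
      rw [zero_add]
      refine le_trans ?_ (h n).2
      rw [pow_mul]
      exact Nat.pow_le_pow_left (prod_le_sq hL h n) L
    have h3 : (((∏ i ∈ Finset.range (n + 1), d i : ℕ) : ℝ)) ^ L ≤ (d (0 + (n + 1)) : ℝ) := by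
      exact_mod_cast h2
    have h4 : (0 : ℝ) < ((∏ i ∈ Finset.range (n + 1), d i : ℕ) : ℝ) := by exact_mod_cast hpos
    gcongr
  have h1 := key d hd h hf
  have h2 := key e he h' hf'
  have h3 := abs_sub (pierceTrad (fun i => d (i + (n + 1)))) (pierceTrad (fun i => e (i + (n + 1))))
  have h4 : (1 / ∏ i ∈ Finset.range (n + 1), (d i : ℝ)) ≤ 1 := by
    have := hd.prod_ge (n + 1)
    have h5 : (1 : ℝ) ≤ (((n + 1).factorial : ℕ) : ℝ) := by exact_mod_cast Nat.factorial_pos _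
    rw [div_le_one (by linarith)]
    linarith
  refine (mul_le_of_le_one_left (abs_nonneg _) h4).trans ?_
  linarith

lemma cyl_two_le {L n : ℕ} {f : Fin (n + 1) → ℕ} (h : (pierceCyl L n f).Nonempty) (i) : 2 ≤ f i := by
  obtain ⟨x, d, hd, h, hf, rfl⟩ := h
  rw [← hf]; exact (h _).1

lemma ediam_cyl_rpow {L : ℕ} (hL : 1 ≤ L) (n : ℕ) (f : Fin (n + 1) → ℕ) :
    Metric.ediam (pierceCyl L n f) ^ ((2 : ℝ) / L) ≤
      ENNReal.ofReal ((2 * (1 + pierceC)) ^ ((2 : ℝ) / L)) * ∏ i, pierceW (f i) := by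
  have hL0 : (0 : ℝ) < L := by exact_mod_cast hL
  have hC := pierceC_nonneg
  rcases (pierceCyl L n f).eq_empty_or_nonempty with he | hne
  · rw [he, Metric.ediam_empty, ENNReal.zero_rpow_of_pos (by positivity)]
    exact zero_le
  have h2 := cyl_two_le hne
  calc _ ≤ ENNReal.ofReal ((2 * (1 + pierceC)) * (1 / ∏ i, (f i : ℝ)) ^ L) ^ ((2 : ℝ) / L) :=
        ENNReal.rpow_le_rpow (ediam_cyl hL n f) (by positivity)
    _ = _ := by
      rw [ENNReal.ofReal_rpow_of_nonneg (by positivity) (by positivity),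
        Real.mul_rpow (by positivity) (by positivity), ENNReal.ofReal_mul (by positivity)]
      congr 1
      simp only [pierceW, h2, if_true]
      rw [← ENNReal.ofReal_prod_of_nonneg (fun i _ => by positivity)]
      congr 1
      rw [← Real.rpow_natCast, ← Real.rpow_mul (by positivity), mul_div_cancel₀ _ hL0.ne',
        Finset.prod_pow, Finset.prod_div_distrib, Finset.prod_const_one]
      exact_mod_cast Real.rpow_natCast _ 2

open MeasureTheory Measure in
lemma dimH_pierceF_zero {L : ℕ} (hL : 1 ≤ L) : dimH (pierceF L 0) ≤ ((2 / L : NNReal) : ENNReal) := by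
  have hC := pierceC_nonneg
  refine dimH_le_of_hausdorffMeasure_ne_top ?_
  have hs : (((2 / L : NNReal)) : ℝ) = (2 : ℝ) / L := by push_cast; rfl
  rw [hs]
  refine ne_top_of_le_ne_top (b := ENNReal.ofReal ((2 * (1 + pierceC)) ^ ((2 : ℝ) / L)))
    ENNReal.ofReal_ne_top ?_
  refine (hausdorffMeasure_le_liminf_tsum ((2 : ℝ) / L) (pierceF L 0) (l := Filter.atTop)
    (fun n : ℕ => ENNReal.ofReal ((2 * (1 + pierceC)) * (1 / 2) ^ (n + 1))) ?_
    (fun n => pierceCyl L n) ?_ ?_).trans ?_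
  · rw [← ENNReal.ofReal_zero]
    refine ENNReal.tendsto_ofReal ?_
    rw [← mul_zero (2 * (1 + pierceC))]
    refine Tendsto.const_mul _ ?_
    exact (tendsto_add_atTop_iff_nat 1).2
      (tendsto_pow_atTop_nhds_zero_of_lt_one (by norm_num) (by norm_num))
  · refine Eventually.of_forall fun n f => ?_
    rcases (pierceCyl L n f).eq_empty_or_nonempty with he | hne
    · rw [he, Metric.ediam_empty]; exact zero_le
    have h2 := cyl_two_le hne
    refine (ediam_cyl hL n f).trans (ENNReal.ofReal_le_ofReal ?_)
    have h3 : (2 : ℝ) ^ (n + 1) ≤ ∏ i, (f i : ℝ) := by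
      have : ∏ i : Fin (n + 1), (2 : ℝ) ≤ ∏ i, (f i : ℝ) :=
        Finset.prod_le_prod (fun _ _ => by norm_num) (fun i _ => by exact_mod_cast h2 i)
      simpa using this
    have h4 : (1 / ∏ i, (f i : ℝ)) ≤ (1 / 2) ^ (n + 1) := by
      rw [one_div_pow]
      exact one_div_le_one_div_of_le (by positivity) h3
    have h5 : (1 / ∏ i, (f i : ℝ)) ≤ 1 := h4.trans (pow_le_one₀ (by norm_num) (by norm_num))
    have h6 : (1 / ∏ i, (f i : ℝ)) ^ L ≤ (1 / ∏ i, (f i : ℝ)) :=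
      pow_le_of_le_one (by positivity) h5 (by omega)
    gcongr
    exact h6.trans h4
  · refine Eventually.of_forall fun n => ?_
    rintro x ⟨d, hd, h, rfl⟩
    exact Set.mem_iUnion.2 ⟨fun i => d i, d, hd, fun n => h n (Nat.zero_le _), fun _ => rfl, rfl⟩
  · refine liminf_le_of_le (by isBoundedDefault) fun b hb => ?_
    obtain ⟨n, hn⟩ := hb.exists
    refine hn.trans ((ENNReal.tsum_le_tsum fun f => ediam_cyl_rpow hL n f).trans ?_)
    rw [ENNReal.tsum_mul_left, tsum_fin_prod]
    exact mul_le_of_le_one_right zero_le (pow_le_one₀ zero_le tsum_pierceW)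

/-- The set of numbers whose traditional Pierce digits `d_n` satisfy
`lim (log d_{n+1})/(log d_n) = ∞` has Hausdorff dimension `0`. -/
theorem dimH_pierce_log_ratio_infty :
    dimH {x : ℝ | ∃ d : ℕ → ℕ, StrictMono d ∧ (∀ n, 0 < d n) ∧
        Tendsto (fun n : ℕ => Real.log (d (n + 1) : ℝ) / Real.log (d n : ℝ)) atTop atTop ∧
        x = pierceTrad d} = 0 := by
  have key : ∀ L : ℕ, 1 ≤ L → dimH {x : ℝ | ∃ d : ℕ → ℕ, StrictMono d ∧ (∀ n, 0 < d n) ∧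
        Tendsto (fun n : ℕ => Real.log (d (n + 1) : ℝ) / Real.log (d n : ℝ)) atTop atTop ∧
        x = pierceTrad d} ≤ ((2 / L : NNReal) : ENNReal) := by
    intro L hL
    refine le_trans (dimH_mono (t := ⋃ N, pierceF L N) ?_) ?_
    · rintro x ⟨d, hd, hpos, ht, rfl⟩
      obtain ⟨N, hN⟩ := eventually_atTop.1 (ht.eventually_ge_atTop ((2 * L : ℕ) : ℝ))
      refine Set.mem_iUnion.2 ⟨N + 1, d, ⟨hd, hpos⟩, fun n hn => ?_, rfl⟩
      have h2 : 2 ≤ d n := by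
        have := hd (show 0 < n by omega)
        have := hpos 0
        omega
      refine ⟨h2, ?_⟩
      have h3 := hN n (by omega)
      have h2' : (1 : ℝ) < d n := by exact_mod_cast h2
      rw [le_div_iff₀ (Real.log_pos h2'), ← Real.log_pow] at h3
      have h4 : (0 : ℝ) < d (n + 1) := by exact_mod_cast hpos _
      rw [Real.log_le_log_iff (by positivity) h4] at h3
      exact_mod_cast h3
    · rw [dimH_iUnion]
      exact iSup_le fun N => (dimH_pierceF_le L N).trans (dimH_pierceF_zero hL)
  have hlim : Tendsto (fun L : ℕ => ((2 / L : NNReal) : ENNReal)) atTop (nhds 0) := by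
    rw [← ENNReal.coe_zero, ENNReal.tendsto_coe]
    exact tendsto_const_div_atTop_nhds_zero_nat 2
  exact le_antisymm (ge_of_tendsto hlim (eventually_atTop.2 ⟨1, key⟩)) zero_le
end

section
/- Let φ : ℕ → (0,∞) be a function with φ(n) → ∞ as n → ∞, and set γ = limsup_{n→∞} (∑_{k=1}^{n+1} φ(k)) / (∑_{k=1}^{n} (n−k+1)·φ(k)). Then dim_H { E'(c) : c = (c_n)_{n≥1} a strictly increasing sequence of integers with c₁ ≥ 2 and lim_{n→∞} (log(c_n/c_{n−1}))/φ(n) = 1 } = 1/(1+γ). -/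
open Filter

open scoped ENNReal

/-- `γ = limsup_n (∑_{k=1}^{n+1} φ(k)) / (∑_{k=1}^{n} (n−k+1)·φ(k))` (as an extended real;
0-based: `φ 0 = φ(1)`). -/
noncomputable def gammaExp (φ : ℕ → ℝ) : ℝ≥0∞ :=
  Filter.limsup (fun n : ℕ => ENNReal.ofReal
    ((∑ k ∈ Finset.range (n + 1), φ k) /
      (∑ k ∈ Finset.range n, ((n - k : ℕ) : ℝ) * φ k))) atTop

namespace ME
open Finset

/-- admissible digit sequences -/
def Adm (c : ℕ → ℕ) : Prop := StrictMono c ∧ 2 ≤ c 0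

lemma Adm.two_le {c : ℕ → ℕ} (h : Adm c) (n : ℕ) : (2:ℝ) ≤ c n := by
  have : c 0 ≤ c n := h.1.monotone (Nat.zero_le n)
  have h2 := h.2
  exact_mod_cast h2.trans this

lemma Adm.lt {c : ℕ → ℕ} (h : Adm c) (n : ℕ) : (c n : ℝ) + 1 ≤ c (n+1) := by
  have : c n < c (n+1) := h.1 (Nat.lt_succ_self n)
  exact_mod_cast this

lemma Adm.shift {c : ℕ → ℕ} (h : Adm c) (m : ℕ) : Adm (fun n => c (n + m)) := by
  refine ⟨fun a b hab => h.1 (by omega), ?_⟩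
  have : c 0 ≤ c (0 + m) := h.1.monotone (by omega)
  exact h.2.trans this

lemma Adm.prod_pos {c : ℕ → ℕ} (h : Adm c) (n : ℕ) :
    0 < ∏ i ∈ range n, ((c i : ℝ) - 1) :=
  Finset.prod_pos fun i _ => by linarith [h.two_le i]

lemma partial_le {c : ℕ → ℕ} (h : Adm c) (n : ℕ) :
    ∑ k ∈ range n, 1 / ((∏ i ∈ range (k + 1), ((c i : ℝ) - 1)) * (c (k + 1) : ℝ))
      ≤ 1 / (∏ i ∈ range 2, ((c i : ℝ) - 1)) - 1 / (∏ i ∈ range (n + 2), ((c i : ℝ) - 1)) := by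
  induction n with
  | zero => simp
  | succ n ih =>
    rw [sum_range_succ]
    have hP := h.prod_pos (n+1)
    have e1 : ∏ i ∈ range (n + 2), ((c i : ℝ) - 1) =
      (∏ i ∈ range (n + 1), ((c i : ℝ) - 1)) * ((c (n+1) : ℝ) - 1) := prod_range_succ _ _
    have e2 : ∏ i ∈ range (n + 1 + 2), ((c i : ℝ) - 1) =
      (∏ i ∈ range (n + 1), ((c i : ℝ) - 1)) * ((c (n+1) : ℝ) - 1) * ((c (n+2) : ℝ) - 1) := by
      rw [← e1]; exact prod_range_succ _ _
    rw [e1] at ih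
    rw [e2]
    set P := ∏ i ∈ range (n + 1), ((c i : ℝ) - 1)
    have h1 := h.two_le (n+1)
    have h2 := h.lt (n+1)
    set x : ℝ := (c (n+1) : ℝ)
    set y : ℝ := (c (n+1+1) : ℝ)
    have key : 1 / (P * x) + 1 / (P * (x - 1) * (y - 1)) ≤ 1 / (P * (x-1)) := by
      have : 1 / (P * (x - 1) * (y - 1)) ≤ 1 / (P * (x - 1) * x) := by
        apply one_div_le_one_div_of_le
        · have : 0 < x - 1 := by linarith
          positivity
        · apply mul_le_mul_of_nonneg_left (by linarith)
          have : 0 < x - 1 := by linarith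
          positivity
      have e : 1 / (P * x) + 1 / (P * (x - 1) * x) = 1 / (P * (x-1)) := by
        have : x - 1 ≠ 0 := by intro h; linarith
        have : x ≠ 0 := by intro h; linarith
        field_simp
        ring
      linarith
    linarith

lemma term_nonneg {c : ℕ → ℕ} (h : Adm c) (k : ℕ) :
    0 ≤ 1 / ((∏ i ∈ range (k + 1), ((c i : ℝ) - 1)) * (c (k + 1) : ℝ)) := by
  have := h.prod_pos (k+1); positivity

lemma partial_le' {c : ℕ → ℕ} (h : Adm c) (n : ℕ) :
    ∑ k ∈ range n, 1 / ((∏ i ∈ range (k + 1), ((c i : ℝ) - 1)) * (c (k + 1) : ℝ))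
      ≤ 1 / (∏ i ∈ range 2, ((c i : ℝ) - 1)) := by
  have h1 := partial_le h n
  have h2 : 0 < 1 / (∏ i ∈ range (n + 2), ((c i : ℝ) - 1)) := by
    have := h.prod_pos (n+2); positivity
  linarith

lemma summ {c : ℕ → ℕ} (h : Adm c) :
    Summable fun k => 1 / ((∏ i ∈ range (k + 1), ((c i : ℝ) - 1)) * (c (k + 1) : ℝ)) :=
  summable_of_sum_range_le (term_nonneg h) (partial_le' h)

lemma le_modEngel {c : ℕ → ℕ} (h : Adm c) : 1 / (c 0 : ℝ) ≤ modEngel c := by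
  unfold modEngel
  have := tsum_nonneg (L := SummationFilter.unconditional ℕ) (term_nonneg h)
  linarith

lemma modEngel_le {c : ℕ → ℕ} (h : Adm c) : modEngel c ≤ 1 / ((c 0 : ℝ) - 1) := by
  unfold modEngel
  have h0 := Real.tsum_le_of_sum_range_le (term_nonneg h) (partial_le' h)
  simp only [prod_range_succ _ 1, prod_range_one] at h0
  have h1 := h.two_le 0
  have h2 := h.lt 0
  simp only [zero_add] at h2
  set x : ℝ := (c 0 : ℝ)
  set y : ℝ := (c 1 : ℝ)
  have hx : 0 < x - 1 := by linarith
  have : 1 / ((x - 1) * (y - 1)) ≤ 1 / ((x - 1) * x) := by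
    apply one_div_le_one_div_of_le
    · positivity
    · apply mul_le_mul_of_nonneg_left (by linarith) hx.le
  have e : 1 / x + 1 / ((x - 1) * x) = 1 / (x-1) := by
    have : x - 1 ≠ 0 := hx.ne'
    have : x ≠ 0 := by intro h; linarith
    field_simp
    ring
  linarith

lemma modEngel_rec {c : ℕ → ℕ} (h : Adm c) :
    modEngel c = 1 / (c 0 : ℝ) + modEngel (fun n => c (n + 1)) / ((c 0 : ℝ) - 1) := by
  unfold modEngel
  rw [(summ h).tsum_eq_zero_add, add_div, ← tsum_div_const]
  congr 1
  congr 1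
  · simp; rw [div_eq_mul_inv]
  · congr 1
    funext n
    rw [prod_range_succ' _ (n+1), div_div]
    congr 1
    ring

lemma modEngel_sub (n : ℕ) : ∀ {c c' : ℕ → ℕ}, Adm c → Adm c' → (∀ i < n, c i = c' i) →
    modEngel c - modEngel c' = (modEngel (fun k => c (k + n)) - modEngel (fun k => c' (k + n)))
      / ∏ i ∈ range n, ((c i : ℝ) - 1) := by
  induction n with
  | zero => intro c c' _ _ _; simp
  | succ n ih =>
    intro c c' h h' he
    rw [modEngel_rec h, modEngel_rec h', ← he 0 (by omega)]
    have := ih (h.shift 1) (h'.shift 1) (fun i hi => he (i+1) (by omega))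
    simp only [add_assoc] at this
    rw [prod_range_succ', ← div_div, ← this]
    ring

/-- the key gap estimate -/
lemma gap (n : ℕ) {c c' : ℕ → ℕ} (h : Adm c) (h' : Adm c') (he : ∀ i < n, c i = c' i)
    (hlt : c n < c' n) :
    ((((c' n : ℝ) - c n) - 1) / (c n * c' n) + 1 / (c n * c (n+1))) /
      (∏ i ∈ range n, (c i : ℝ)) ≤ modEngel c - modEngel c' := by
  rw [modEngel_sub n h h' he]
  have a1 := modEngel_rec (h.shift n)
  have a2 := le_modEngel ((h.shift n).shift 1)
  have a3 := modEngel_le (h'.shift n)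
  simp only [zero_add] at a1 a2 a3
  rw [add_comm 1 n] at a2
  have b1 := h.two_le n
  have b2 := h'.two_le n
  have b3 := h.two_le (n+1)
  have b4 : (c n : ℝ) + 1 ≤ c' n := by exact_mod_cast hlt
  have hpos : (0:ℝ) < ∏ i ∈ range n, (c i : ℝ) := Finset.prod_pos fun i _ => by linarith [h.two_le i]
  set x : ℝ := (c n : ℝ)
  set x' : ℝ := (c' n : ℝ)
  set y : ℝ := (c (n+1) : ℝ)
  have hy : 0 < 1 / y := by positivity
  have hx1 : 0 < x - 1 := by linarith
  have hx1' : 0 < x' - 1 := by linarith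
  set Z := modEngel (fun k => c (k + 1 + n))
  have c1 : 1 / (x * y) ≤ Z / (x - 1) := by
    calc 1 / (x * y) = (1 / y) / x := by rw [div_div]; ring
    _ ≤ (1/y) / (x - 1) := by
        apply div_le_div_of_nonneg_left hy.le hx1 (by linarith)
    _ ≤ Z / (x-1) := by
        apply div_le_div_of_nonneg_right a2 hx1.le
  have c2 : ((x' - x) - 1) / (x * x') ≤ 1 / x - 1 / (x' - 1) := by
    have : 1 / x - 1 / (x' - 1) = ((x' - x) - 1) / (x * (x' - 1)) := by
      have : x ≠ 0 := by intro h; linarith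
      field_simp
      ring
    rw [this]
    apply div_le_div_of_nonneg_left (by linarith) (by positivity)
    apply mul_le_mul_of_nonneg_left (by linarith) (by linarith)
  have c3 : ((x' - x) - 1) / (x * x') + 1 / (x * y) ≤
     modEngel (fun k => c (k + n)) - modEngel (fun k => c' (k + n)) := by linarith
  have c0 : 0 ≤ ((x' - x) - 1) / (x * x') + 1 / (x * y) := by
    have : 0 ≤ ((x' - x) - 1) := by linarith
    positivity
  apply div_le_div₀ (c0.trans c3) c3 (h.prod_pos n)
  exact prod_le_prod (fun i _ => by linarith [h.two_le i]) (fun i _ => by linarith)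

lemma close (n : ℕ) {c c' : ℕ → ℕ} (h : Adm c) (h' : Adm c') (he : ∀ i < n, c i = c' i)
    (B : ℝ) (hB : 0 < B) (h1 : B ≤ c n) (h2 : B ≤ c' n) :
    |modEngel c - modEngel c'| ≤ 2 ^ (n+1) / ((∏ i ∈ range n, (c i : ℝ)) * B) := by
  rw [modEngel_sub n h h' he]
  have a1 := modEngel_le (h.shift n)
  have a2 := modEngel_le (h'.shift n)
  have a3 := le_modEngel (h.shift n)
  have a4 := le_modEngel (h'.shift n)
  simp only [zero_add] at a1 a2 a3 a4
  have b1 := h.two_le n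
  have b2 := h'.two_le n
  have bd : ∀ x : ℝ, 2 ≤ x → B ≤ x → 1 / (x - 1) ≤ 2 / B := by
    intro x hx hxB
    rw [div_le_div_iff₀ (by linarith) hB]
    linarith
  have p1 : (0:ℝ) ≤ 1 / c n := by positivity
  have p2 : (0:ℝ) ≤ 1 / c' n := by positivity
  have q1 := bd _ b1 h1
  have q2 := bd _ b2 h2
  have hP : (∏ i ∈ range n, (c i : ℝ)) / 2 ^ n ≤ ∏ i ∈ range n, ((c i : ℝ) - 1) := by
    have : (∏ i ∈ range n, (c i : ℝ)) / 2 ^ n = ∏ i ∈ range n, ((c i : ℝ) / 2) := by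
      rw [prod_div_distrib]; simp
    rw [this]
    exact prod_le_prod (fun i _ => by positivity) (fun i _ => by linarith [h.two_le i])
  have hpos : (0:ℝ) < ∏ i ∈ range n, (c i : ℝ) := Finset.prod_pos fun i _ => by linarith [h.two_le i]
  rw [abs_div, abs_of_pos (h.prod_pos n)]
  calc _ ≤ (2 / B) / ((∏ i ∈ range n, (c i : ℝ)) / 2 ^ n) := by
        apply div_le_div₀ (by positivity) _ (by positivity) hP
        rw [abs_le]; constructor <;> linarith
    _ = _ := by field_simp; ring

end ME

namespace ME
open Finset

/-- products of the radices -/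
def QQ (a : ℕ → ℕ) (n : ℕ) : ℕ := ∏ k ∈ range n, a k

/-- the digit sequence attached to `t` -/
noncomputable def dig (a : ℕ → ℕ) (t : ℝ) (k : ℕ) : ℕ := a k + ⌊(QQ a (k+1) : ℝ) * t⌋₊ % a k

lemma QQ_succ (a : ℕ → ℕ) (n : ℕ) : QQ a (n+1) = QQ a n * a n := prod_range_succ _ _

lemma QQ_ge {a : ℕ → ℕ} (ha : ∀ k, 2 ≤ a k) (n : ℕ) : 2 ^ n ≤ QQ a n := by
  induction n with
  | zero => simp [QQ]
  | succ n ih => rw [QQ_succ, pow_succ]; exact Nat.mul_le_mul ih (ha n)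

lemma dig_lt {a : ℕ → ℕ} (ha : ∀ k, 2 ≤ a k) (t : ℝ) (k : ℕ) : dig a t k < 2 * a k := by
  have := Nat.mod_lt ⌊(QQ a (k+1) : ℝ) * t⌋₊ (show 0 < a k by linarith [ha k])
  unfold dig; omega

lemma le_dig (a : ℕ → ℕ) (t : ℝ) (k : ℕ) : a k ≤ dig a t k := Nat.le_add_right _ _

lemma dig_adm {a : ℕ → ℕ} (ha : ∀ k, 2 ≤ a k) (hd : ∀ k, 2 * a k ≤ a (k+1)) (t : ℝ) :
    Adm (dig a t) := by
  refine ⟨strictMono_nat_of_lt_succ fun k => ?_, (ha 0).trans (le_dig a t 0)⟩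
  exact ((dig_lt ha t k).trans_le (hd k)).trans_le (le_dig a t (k+1))

lemma floor_div {a : ℕ → ℕ} (ha : ∀ k, 2 ≤ a k) (t : ℝ) (k : ℕ) :
    ⌊(QQ a (k+1) : ℝ) * t⌋₊ / a k = ⌊(QQ a k : ℝ) * t⌋₊ := by
  rw [← Nat.floor_div_natCast, QQ_succ]
  congr 1
  have : (a k : ℝ) ≠ 0 := by have := ha k; positivity
  push_cast
  field_simp

set_option maxHeartbeats 1000000 in
lemma key_holder {a : ℕ → ℕ} (ha : ∀ k, 2 ≤ a k) (hd : ∀ k, 2 * a k ≤ a (k+1))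
    {s C : ℝ} (hs : 0 < s) (hs1 : s ≤ 1) (hC : ∀ n, 2 ^ n * (QQ a (n+1) : ℝ) ^ s ≤ C * QQ a n)
    {t t' : ℝ} (h0 : 0 ≤ t) (htt : t < t') (h1 : t' < 1) :
    t' - t ≤ 16 * C * (modEngel (dig a t) - modEngel (dig a t')) ^ s ∧
      0 < modEngel (dig a t) - modEngel (dig a t') := by
  have hQpos : ∀ n, (0:ℝ) < QQ a n := fun n => by
    have := QQ_ge ha n
    have : 0 < QQ a n := lt_of_lt_of_le (by positivity) this
    exact_mod_cast this
  have hapos : ∀ n, (0:ℝ) < a n := fun n => by have := ha n; positivity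
  have hCpos : 0 < C := by
    have := hC 0
    have h2 : 0 < 2 ^ 0 * (QQ a (0+1) : ℝ) ^ s := by have := hQpos 1; positivity
    exact pos_of_mul_pos_left (h2.trans_le this) (hQpos 0).le
  have hex : ∃ n, ⌊(QQ a n : ℝ) * t⌋₊ ≠ ⌊(QQ a n : ℝ) * t'⌋₊ := by
    obtain ⟨n, hn⟩ := pow_unbounded_of_one_lt (1 / (t' - t)) (one_lt_two (α := ℝ))
    refine ⟨n, fun heq => ?_⟩
    have hq : (2:ℝ)^n ≤ QQ a n := by exact_mod_cast QQ_ge ha n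
    have h3 : 1 / (t' - t) < QQ a n := hn.trans_le hq
    rw [div_lt_iff₀ (by linarith)] at h3
    have h4 := Nat.floor_le (show 0 ≤ (QQ a n : ℝ) * t from mul_nonneg (hQpos n).le h0)
    have h5 := Nat.lt_floor_add_one ((QQ a n : ℝ) * t')
    rw [← heq] at h5
    nlinarith
  obtain ⟨n, hn, hmin⟩ : ∃ n, ⌊(QQ a (n+1) : ℝ) * t⌋₊ ≠ ⌊(QQ a (n+1) : ℝ) * t'⌋₊ ∧
      ∀ k ≤ n, ⌊(QQ a k : ℝ) * t⌋₊ = ⌊(QQ a k : ℝ) * t'⌋₊ := by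
    classical
    have hne : Nat.find hex ≠ 0 := by
      intro h
      have := Nat.find_spec hex
      rw [h] at this
      apply this
      have e1 : ⌊t⌋₊ = 0 := Nat.floor_eq_zero.2 (by linarith)
      have e2 : ⌊t'⌋₊ = 0 := Nat.floor_eq_zero.2 (by linarith)
      simp [QQ, e1, e2]
    obtain ⟨n, hn⟩ := Nat.exists_eq_succ_of_ne_zero hne
    refine ⟨n, ?_, fun k hk => ?_⟩
    · have := Nat.find_spec hex
      rwa [hn] at this
    · have := Nat.find_min hex (m := k) (by omega)
      simpa using this
  have hdig : ∀ k < n, dig a t k = dig a t' k := fun k hk => by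
    unfold dig; rw [hmin (k+1) hk]
  have d1 := floor_div ha t n
  have d2 := floor_div ha t' n
  have hle : ⌊(QQ a (n+1) : ℝ) * t⌋₊ ≤ ⌊(QQ a (n+1) : ℝ) * t'⌋₊ :=
    Nat.floor_le_floor (mul_le_mul_of_nonneg_left htt.le (hQpos _).le)
  have f1 := Nat.floor_le (show 0 ≤ (QQ a (n+1) : ℝ) * t from mul_nonneg (hQpos _).le h0)
  have f2 := Nat.lt_floor_add_one ((QQ a (n+1) : ℝ) * t')
  have e1 : dig a t n = a n + ⌊(QQ a (n+1) : ℝ) * t⌋₊ % a n := rfl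
  have e2 : dig a t' n = a n + ⌊(QQ a (n+1) : ℝ) * t'⌋₊ % a n := rfl
  have r1 := Nat.div_add_mod ⌊(QQ a (n+1) : ℝ) * t⌋₊ (a n)
  have r2 := Nat.div_add_mod ⌊(QQ a (n+1) : ℝ) * t'⌋₊ (a n)
  rw [d1] at r1
  rw [d2, ← hmin n le_rfl] at r2
  have hsum : dig a t n + ⌊(QQ a (n+1) : ℝ) * t'⌋₊ = dig a t' n + ⌊(QQ a (n+1) : ℝ) * t⌋₊ := by
    omega
  set m := ⌊(QQ a (n+1) : ℝ) * t⌋₊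
  set m' := ⌊(QQ a (n+1) : ℝ) * t'⌋₊
  have hlt : dig a t n < dig a t' n := by omega
  have hG := gap n (dig_adm ha hd t) (dig_adm ha hd t') hdig hlt
  set η := modEngel (dig a t) - modEngel (dig a t')
  set D : ℝ := (dig a t' n : ℝ) - dig a t n with hD
  have hDm : D = (m' : ℝ) - m := by
    have : (dig a t n : ℝ) + m' = dig a t' n + m := by exact_mod_cast hsum
    linarith
  have hD1 : 1 ≤ D := by
    have : (dig a t n : ℝ) + 1 ≤ dig a t' n := by exact_mod_cast hlt
    linarith
  have u1 : (dig a t n : ℝ) ≤ 2 * a n := by exact_mod_cast (dig_lt ha t n).le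
  have u2 : (dig a t' n : ℝ) ≤ 2 * a n := by exact_mod_cast (dig_lt ha t' n).le
  have u3 : (dig a t (n+1) : ℝ) ≤ 2 * a (n+1) := by exact_mod_cast (dig_lt ha t (n+1)).le
  have l1 : (a n : ℝ) ≤ dig a t n := by exact_mod_cast le_dig a t n
  have l2 : (a n : ℝ) ≤ dig a t' n := by exact_mod_cast le_dig a t' n
  have l3 : (a (n+1) : ℝ) ≤ dig a t (n+1) := by exact_mod_cast le_dig a t (n+1)
  have hDa : D ≤ a n := by linarith
  have hPQ : ∏ i ∈ range n, (dig a t i : ℝ) ≤ 2 ^ n * QQ a n := by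
    have : (2:ℝ) ^ n * QQ a n = ∏ i ∈ range n, (2 * (a i : ℝ)) := by
      rw [prod_mul_distrib]; simp [QQ]
    rw [this]
    exact prod_le_prod (fun i _ => by positivity)
      (fun i _ => by exact_mod_cast (dig_lt ha t i).le)
  have hPpos : 0 < ∏ i ∈ range n, (dig a t i : ℝ) := Finset.prod_pos fun i _ => by
    have := hapos i
    have h : (a i : ℝ) ≤ dig a t i := by exact_mod_cast le_dig a t i
    linarith
  have A0 := hapos n
  have A1 := hapos (n+1)
  have Q0 := hQpos n
  have eQ1 : (QQ a (n+1) : ℝ) = QQ a n * a n := by rw [QQ_succ]; push_cast; ring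
  have eQ2 : (QQ a (n+2) : ℝ) = QQ a n * a n * a (n+1) := by
    rw [QQ_succ, QQ_succ]; push_cast; ring
  have hη : ((D - 1) / (4 * (a n : ℝ)^2) + 1 / (4 * a n * a (n+1))) / (2 ^ n * QQ a n) ≤ η := by
    refine le_trans ?_ hG
    have hDD : 0 ≤ D - 1 := by linarith
    apply div_le_div₀ _ _ hPpos hPQ
    · positivity
    · apply add_le_add
      · apply div_le_div_of_nonneg_left hDD (by nlinarith) (by nlinarith)
      · apply one_div_le_one_div_of_le (by nlinarith)
        nlinarith
  have htd : t' - t ≤ 2 * D / QQ a (n+1) := by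
    rw [le_div_iff₀ (hQpos _)]
    linarith
  have hηpos : 0 < η := by
    refine lt_of_lt_of_le ?_ hη
    have hDD : 0 ≤ D - 1 := by linarith
    positivity
  refine ⟨?_, hηpos⟩
  have pow2 : ∀ k : ℕ, ((2:ℝ)^k) ^ s ≤ 2 ^ k := fun k => by
    calc ((2:ℝ)^k) ^ s ≤ ((2:ℝ)^k) ^ (1:ℝ) :=
          Real.rpow_le_rpow_of_exponent_le (one_le_pow₀ (by norm_num)) hs1
      _ = _ := Real.rpow_one _
  -- reduce to an inequality on η from below
  have fin : ∀ x y : ℝ, 0 ≤ x → x ≤ η → y ≤ 16 * C * x ^ s → y ≤ 16 * C * η ^ s := by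
    intro x y hx hxη hy
    refine hy.trans ?_
    have := Real.rpow_le_rpow hx hxη hs.le
    exact mul_le_mul_of_nonneg_left this (by positivity)
  rcases le_or_gt 2 D with h2 | h2
  · refine fin (D / (2 ^ (n+3) * (a n * QQ a (n+1)))) _ (by positivity) ?_ ?_
    · refine le_trans ?_ hη
      have : D / (2 ^ (n+3) * (a n * QQ a (n+1))) = (D/2/ (4 * (a n : ℝ)^2)) / (2 ^ n * QQ a n) := by
        rw [eQ1]; field_simp; ring
      rw [this]
      apply div_le_div_of_nonneg_right _ (by positivity)
      have : D / 2 / (4 * (a n : ℝ)^2) ≤ (D - 1) / (4 * (a n : ℝ)^2) :=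
        div_le_div_of_nonneg_right (by linarith) (by positivity)
      have : 0 ≤ 1 / (4 * (a n : ℝ) * a (n+1)) := by positivity
      linarith
    · refine htd.trans ?_
      have hDpos : 0 < D := by linarith
      rw [Real.div_rpow hDpos.le (by have := hQpos (n+1); positivity),
        Real.mul_rpow (by positivity) (by have := hQpos (n+1); positivity),
        Real.mul_rpow A0.le (hQpos _).le]
      have hC' := hC n
      have p2 := pow2 (n+3)
      have hDs : D ≤ D ^ s * (a n / (a n : ℝ)^s) := by
        have e : (a n / (a n : ℝ)^s) = (a n : ℝ) ^ (1 - s) := by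
          rw [Real.rpow_sub A0, Real.rpow_one]
        rw [e]
        calc D = D ^ s * D ^ (1 - s) := by rw [← Real.rpow_add hDpos]; simp
          _ ≤ _ := by
            apply mul_le_mul_of_nonneg_left _ (by positivity)
            exact Real.rpow_le_rpow hDpos.le hDa (by linarith)
      have hqs : 0 < (QQ a (n+1) : ℝ) ^ s := Real.rpow_pos_of_pos (hQpos _) _
      have has : 0 < (a n : ℝ) ^ s := Real.rpow_pos_of_pos A0 _
      have hDs0 : 0 < D ^ s := Real.rpow_pos_of_pos hDpos _
      have h2s : 0 < ((2:ℝ) ^ (n+3))^s := by positivity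
      calc 2 * D / QQ a (n+1) ≤ 2 * (D ^ s * (a n / (a n : ℝ)^s)) / QQ a (n+1) := by
            apply div_le_div_of_nonneg_right _ (hQpos _).le
            linarith
        _ = D ^ s / (a n : ℝ) ^ s * (2 / QQ a n) := by
            rw [eQ1]; field_simp
        _ ≤ D ^ s / (a n : ℝ) ^ s * (16 * C / (((2:ℝ) ^ (n+3))^s * (QQ a (n+1) : ℝ) ^ s)) := by
            apply mul_le_mul_of_nonneg_left _ (by positivity)
            rw [div_le_div_iff₀ Q0 (by positivity)]
            have : ((2:ℝ) ^ (n+3))^s * (QQ a (n+1) : ℝ) ^ s ≤ 2 ^ (n+3) * (QQ a (n+1) : ℝ) ^ s :=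
              mul_le_mul_of_nonneg_right p2 hqs.le
            have e : (2:ℝ) ^ (n+3) * (QQ a (n+1) : ℝ) ^ s = 8 * (2 ^ n * (QQ a (n+1) : ℝ) ^ s) := by
              rw [pow_add]; ring
            nlinarith
        _ = _ := by field_simp
  · have hD' : D = 1 := by
      have : (dig a t' n : ℝ) < dig a t n + 2 := by linarith
      have h3 : dig a t' n < dig a t n + 2 := by exact_mod_cast this
      have h4 : dig a t' n = dig a t n + 1 := by omega
      rw [hD, h4]; push_cast; ring
    refine fin (1 / (2 ^ (n+2) * QQ a (n+2))) _ (by positivity) ?_ ?_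
    · refine le_trans (le_of_eq ?_) hη
      rw [hD', eQ2]; field_simp; ring
    · refine htd.trans ?_
      rw [hD', Real.div_rpow (by norm_num) (by have := hQpos (n+2); positivity), Real.one_rpow,
        Real.mul_rpow (by positivity) (hQpos _).le]
      have hC' := hC (n+1)
      have p2 := pow2 (n+2)
      have hqs : 0 < (QQ a (n+2) : ℝ) ^ s := Real.rpow_pos_of_pos (hQpos _) _
      rw [mul_one_div, div_le_div_iff₀ (hQpos _) (by positivity)]
      have : ((2:ℝ) ^ (n+2))^s * (QQ a (n+2) : ℝ) ^ s ≤ 2 ^ (n+2) * (QQ a (n+2) : ℝ) ^ s :=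
        mul_le_mul_of_nonneg_right p2 hqs.le
      have e : (2:ℝ) ^ (n+2) * (QQ a (n+2) : ℝ) ^ s = 2 * (2 ^ (n+1) * (QQ a (n+1+1) : ℝ) ^ s) := by
        rw [pow_succ _ (n+1)]; ring
      have := hQpos (n+1)
      nlinarith

lemma dimH_lower {a : ℕ → ℕ} (ha : ∀ k, 2 ≤ a k) (hd : ∀ k, 2 * a k ≤ a (k+1))
    {s : NNReal} {C : ℝ} (hs : 0 < s) (hs1 : s ≤ 1)
    (hC : ∀ n, 2 ^ n * (QQ a (n+1) : ℝ) ^ (s:ℝ) ≤ C * QQ a n)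
    {E : Set ℝ} (hE : ∀ t, modEngel (dig a t) ∈ E) : (s : ENNReal) ≤ dimH E := by
  set g : ℝ → ℝ := fun t => modEngel (dig a t)
  set I : Set ℝ := Set.Ico 0 1
  have key := fun (t t' : ℝ) (h0 : 0 ≤ t) (htt : t < t') (h1 : t' < 1) =>
    key_holder ha hd (s := s) (C := C) (by exact_mod_cast hs) (by exact_mod_cast hs1) hC h0 htt h1
  have hinj : Set.InjOn g I := by
    intro t ht t' ht' h
    by_contra hne
    rcases lt_or_gt_of_ne hne with hl | hl
    · have := (key t t' ht.1 hl ht'.2).2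
      simp only [g] at h; linarith
    · have := (key t' t ht'.1 hl ht.2).2
      simp only [g] at h; linarith
  set f := Function.invFunOn g I
  have hf : ∀ t ∈ I, f (g t) = t := fun t ht => hinj.leftInvOn_invFunOn ht
  have hH : HolderOnWith (Real.toNNReal (16 * C)) s f (g '' I) := by
    have main : ∀ t ∈ I, ∀ t' ∈ I, t < t' →
        edist t t' ≤ (Real.toNNReal (16 * C)) * edist (g t) (g t') ^ (s:ℝ) := by
      intro t ht t' ht' hl
      obtain ⟨k1, k2⟩ := key t t' ht.1 hl ht'.2
      rw [edist_comm t, edist_dist, edist_dist, Real.dist_eq, Real.dist_eq, abs_of_pos (by linarith),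
        abs_of_pos k2, ENNReal.ofReal_rpow_of_nonneg k2.le s.coe_nonneg]
      rw [show ((Real.toNNReal (16 * C) : NNReal) : ENNReal) = ENNReal.ofReal (16 * C) from rfl,
        ← ENNReal.ofReal_mul' (by positivity)]
      exact ENNReal.ofReal_le_ofReal k1
    rintro _ ⟨t, ht, rfl⟩ _ ⟨t', ht', rfl⟩
    rw [hf t ht, hf t' ht']
    rcases lt_trichotomy t t' with hl | hl | hl
    · exact main t ht t' ht' hl
    · rw [hl]; simp
    · rw [edist_comm, edist_comm (g t)]
      exact main t' ht' t ht hl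
  have h1 := hH.dimH_image_le hs
  have h2 : f '' (g '' I) = I := by
    rw [← Set.image_comp]
    ext x; constructor
    · rintro ⟨t, ht, rfl⟩; simpa [hf t ht] using ht
    · intro hx; exact ⟨x, hx, hf x hx⟩
  have h3 : dimH I = 1 := by
    have := Real.dimH_of_nonempty_interior (s := I) (by simp [I])
    simpa using this
  rw [h2, h3] at h1
  rw [ENNReal.le_div_iff_mul_le (Or.inl (by simpa using hs.ne')) (Or.inl (by simp)), one_mul] at h1
  refine h1.trans (dimH_mono ?_)
  rintro _ ⟨t, _, rfl⟩
  exact hE t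

end ME

namespace ME
open Finset Asymptotics

/-- partial sums -/
def SS (φ : ℕ → ℝ) (n : ℕ) : ℝ := ∑ k ∈ range (n + 1), φ k
/-- sums of partial sums -/
def AA (φ : ℕ → ℝ) (n : ℕ) : ℝ := ∑ k ∈ range n, SS φ k

lemma AA_succ (φ : ℕ → ℝ) (n : ℕ) : AA φ (n+1) = AA φ n + SS φ n := sum_range_succ _ _

lemma AA_eq (φ : ℕ → ℝ) (n : ℕ) : ∑ k ∈ range n, ((n - k : ℕ) : ℝ) * φ k = AA φ n := by
  induction n with
  | zero => simp [AA]
  | succ n ih =>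
    rw [AA_succ, ← ih, SS, sum_range_succ, sum_range_succ, ← add_assoc, ← sum_add_distrib]
    congr 1
    · apply sum_congr rfl
      intro k hk
      rw [mem_range] at hk
      rw [Nat.succ_sub hk.le]; push_cast; ring
    · simp

lemma gamma_eq (φ : ℕ → ℝ) : gammaExp φ =
    Filter.limsup (fun n : ℕ => ENNReal.ofReal (SS φ n / AA φ n)) atTop := by
  unfold gammaExp
  simp only [AA_eq]
  rfl

variable {φ : ℕ → ℝ}

lemma SS_pos (hp : ∀ n, 0 < φ n) (n : ℕ) : 0 < SS φ n :=
  sum_pos (fun i _ => hp i) (by simp)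

lemma AA_pos (hp : ∀ n, 0 < φ n) {n : ℕ} (hn : 1 ≤ n) : 0 < AA φ n :=
  sum_pos (fun i _ => SS_pos hp i) (by simp; omega)

lemma AA_nonneg (hp : ∀ n, 0 < φ n) (n : ℕ) : 0 ≤ AA φ n :=
  sum_nonneg (fun i _ => (SS_pos hp i).le)

lemma SS_tendsto (hp : ∀ n, 0 < φ n) (h : Tendsto φ atTop atTop) : Tendsto (SS φ) atTop atTop :=
  tendsto_atTop_mono (fun n => single_le_sum (f := φ) (fun i _ => (hp i).le)
    (mem_range.2 (Nat.lt_succ_self n))) h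

lemma AA_tendsto (hp : ∀ n, 0 < φ n) (h : Tendsto φ atTop atTop) : Tendsto (AA φ) atTop atTop := by
  rw [← tendsto_add_atTop_iff_nat 1]
  exact tendsto_atTop_mono (fun n => single_le_sum (f := SS φ) (fun i _ => (SS_pos hp i).le)
    (mem_range.2 (Nat.lt_succ_self n))) (SS_tendsto hp h)

lemma lin_o (hp : ∀ n, 0 < φ n) (h : Tendsto φ atTop atTop) :
    (fun n : ℕ => ∑ k ∈ range n, ((k:ℝ) + 1)) =o[atTop] AA φ := by
  have h1 : (fun _ : ℕ => (1:ℝ)) =o[atTop] φ := by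
    rw [isLittleO_const_left]
    right
    exact tendsto_norm_atTop_atTop.comp h
  have hS : Tendsto (fun n => ∑ i ∈ range n, φ i) atTop atTop := by
    rw [← tendsto_add_atTop_iff_nat 1]; exact SS_tendsto hp h
  have h2 := (h1.sum_range (fun n => (hp n).le) hS).comp_tendsto (tendsto_add_atTop_nat 1)
  have h3 : (fun n : ℕ => (n:ℝ) + 1) =o[atTop] SS φ := by
    refine h2.congr (fun n => ?_) (fun n => rfl)
    simp
  exact h3.sum_range (fun n => (SS_pos hp n).le) (AA_tendsto hp h)

lemma quad_le (hp : ∀ n, 0 < φ n) (h : Tendsto φ atTop atTop) {M δ : ℝ} (hM : 0 < M) (hδ : 0 < δ) :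
    ∀ᶠ n in atTop, M * ∑ k ∈ range n, ((k:ℝ) + 1) ≤ δ * AA φ n := by
  have := (lin_o hp h).def (div_pos hδ hM)
  filter_upwards [this] with n hn
  rw [Real.norm_of_nonneg (sum_nonneg fun i _ => by positivity),
    Real.norm_of_nonneg (AA_nonneg hp n)] at hn
  calc _ ≤ M * (δ / M * AA φ n) := mul_le_mul_of_nonneg_left hn hM.le
    _ = _ := by field_simp

lemma lin_le (hp : ∀ n, 0 < φ n) (h : Tendsto φ atTop atTop) {M δ : ℝ} (hM : 0 < M) (hδ : 0 < δ) :
    ∀ᶠ n : ℕ in atTop, M * ((n:ℝ) + 1) ≤ δ * AA φ n := by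
  filter_upwards [quad_le hp h (show 0 < M * 2 by positivity) hδ, eventually_ge_atTop 1] with n hn h1
  refine le_trans ?_ hn
  have : (n:ℝ) ≤ ∑ k ∈ range n, ((k:ℝ) + 1) := by
    calc (n:ℝ) = ∑ k ∈ range n, (1:ℝ) := by simp
      _ ≤ _ := sum_le_sum fun i _ => by linarith [(Nat.cast_nonneg i : (0:ℝ) ≤ i)]
  have h1' : (1:ℝ) ≤ n := by exact_mod_cast h1
  rw [mul_assoc]
  exact mul_le_mul_of_nonneg_left (by linarith) hM.le

lemma gamma_lower (hp : ∀ n, 0 < φ n) {s : NNReal} (hs : (s:ENNReal) < 1 / (1 + gammaExp φ)) :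
    ∃ δ > 0, ∀ᶠ n in atTop, ((s:ℝ) + δ) * AA φ (n+1) ≤ AA φ n := by
  have hne : gammaExp φ ≠ ⊤ := by
    intro h; rw [h] at hs; simp at hs
  obtain ⟨g, hg⟩ : ∃ g : NNReal, gammaExp φ = g := ⟨_, (ENNReal.coe_toNNReal hne).symm⟩
  rw [hg] at hs
  have h1 : (s:ℝ) * (1 + g) < 1 := by
    rw [ENNReal.lt_div_iff_mul_lt (by simp) (by simp)] at hs
    exact_mod_cast hs
  have h2 : (s:ℝ) < 1 / (1 + g) := by
    rw [lt_div_iff₀ (by positivity)]; exact h1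
  obtain ⟨u, hu1, hu2⟩ := exists_between h2
  have hu0 : 0 < u := s.coe_nonneg.trans_lt hu1
  have hgu : (g:ℝ) < 1 / u - 1 := by
    rw [lt_div_iff₀ (by positivity)] at hu2
    rw [lt_sub_iff_add_lt, lt_div_iff₀ hu0]; linarith
  refine ⟨u - s, by linarith, ?_⟩
  have h3 : gammaExp φ < ENNReal.ofReal (1 / u - 1) := by
    rw [hg, ← ENNReal.ofReal_coe_nnreal]
    exact (ENNReal.ofReal_lt_ofReal_iff (g.coe_nonneg.trans_lt hgu)).2 hgu
  rw [gamma_eq] at h3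
  filter_upwards [eventually_lt_of_limsup_lt h3, eventually_ge_atTop 1] with n hn hn1
  have hA := AA_pos hp hn1
  rw [ENNReal.ofReal_lt_ofReal_iff (g.coe_nonneg.trans_lt hgu), div_lt_iff₀ hA] at hn
  rw [AA_succ]
  have : u * (AA φ n + SS φ n) ≤ u * (AA φ n + (1/u - 1) * AA φ n) :=
    mul_le_mul_of_nonneg_left (by linarith) hu0.le
  have e : u * (AA φ n + (1/u - 1) * AA φ n) = AA φ n := by field_simp; ring
  have e2 : (s:ℝ) + (u - s) = u := by ring
  rw [e2]; linarith

lemma gamma_upper (hp : ∀ n, 0 < φ n) {s : NNReal} (hs : 1 / (1 + gammaExp φ) < (s:ENNReal)) :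
    ∃ q > 1, ∃ᶠ n in atTop, q * AA φ n ≤ s * AA φ (n+1) := by
  have hs0 : (0:ℝ) < s := by
    have : (0:ENNReal) < s := lt_of_le_of_lt bot_le hs
    exact_mod_cast this
  rcases lt_or_ge 1 (s:ℝ) with h1 | h1
  · refine ⟨s, h1, Eventually.frequently (Eventually.of_forall fun n => ?_)⟩
    apply mul_le_mul_of_nonneg_left _ hs0.le
    rw [AA_succ]; linarith [SS_pos hp n]
  · have h0 : 0 ≤ 1 / (s:ℝ) - 1 := by
      rw [sub_nonneg, le_div_iff₀ hs0]; linarith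
    have h2 : ENNReal.ofReal (1 / (s:ℝ) - 1) < gammaExp φ := by
      by_cases ht : gammaExp φ = ⊤
      · rw [ht]; exact ENNReal.ofReal_lt_top
      obtain ⟨g, hg⟩ : ∃ g : NNReal, gammaExp φ = g := ⟨_, (ENNReal.coe_toNNReal ht).symm⟩
      rw [hg] at hs ⊢
      have h3 : 1 < (s:ℝ) * (1 + g) := by
        rw [ENNReal.div_lt_iff (by simp) (by simp)] at hs
        exact_mod_cast hs
      rw [ENNReal.ofReal_lt_iff_lt_toReal h0 (by simp), sub_lt_iff_lt_add, ENNReal.coe_toReal, div_lt_iff₀ hs0]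
      linarith
    obtain ⟨v, hv1, hv2⟩ := exists_between h2
    have hvt : v ≠ ⊤ := ne_top_of_lt hv2
    obtain ⟨w, rfl⟩ : ∃ w : NNReal, v = w := ⟨_, (ENNReal.coe_toNNReal hvt).symm⟩
    rw [ENNReal.ofReal_lt_iff_lt_toReal h0 (by simp), ENNReal.coe_toReal] at hv1
    refine ⟨s * (1 + w), ?_, ?_⟩
    · rw [sub_lt_iff_lt_add, div_lt_iff₀ hs0] at hv1
      show 1 < (s:ℝ) * (1 + w)
      linarith
    · rw [gamma_eq] at hv2
      have := frequently_lt_of_lt_limsup (by isBoundedDefault) hv2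
      refine (this.and_eventually (eventually_ge_atTop 1)).mono ?_
      rintro n ⟨hn, hn1⟩
      have hA := AA_pos hp hn1
      rw [← ENNReal.ofReal_coe_nnreal] at hn
      have hn' := (ENNReal.ofReal_lt_ofReal_iff_of_nonneg w.coe_nonneg).1 hn
      rw [lt_div_iff₀ hA] at hn'
      rw [mul_assoc, AA_succ]
      exact mul_le_mul_of_nonneg_left (by linarith) hs0.le

end ME

namespace ME
open Finset Asymptotics

variable {φ : ℕ → ℝ}

/-- exponents for the Cantor subset -/
def TT (φ : ℕ → ℝ) (n : ℕ) : ℝ := ∑ k ∈ range (n + 1), (φ k + 2)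

/-- lower ends of the digit ranges -/
noncomputable def aa (φ : ℕ → ℝ) (n : ℕ) : ℕ := ⌈Real.exp (TT φ n)⌉₊

lemma TT_succ (n : ℕ) : TT φ (n+1) = TT φ n + (φ (n+1) + 2) := sum_range_succ _ _

lemma TT_eq (n : ℕ) : TT φ n = SS φ n + 2 * (n + 1) := by
  simp [TT, SS, sum_add_distrib]; ring

lemma TT_nonneg (hp : ∀ n, 0 < φ n) (n : ℕ) : 0 ≤ TT φ n :=
  sum_nonneg fun i _ => by linarith [hp i]

lemma aa_ge (n : ℕ) : Real.exp (TT φ n) ≤ aa φ n := Nat.le_ceil _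

lemma aa_le (hp : ∀ n, 0 < φ n) (n : ℕ) : (aa φ n : ℝ) ≤ 2 * Real.exp (TT φ n) := by
  have h1 := Nat.ceil_lt_add_one (Real.exp_pos (TT φ n)).le
  have h2 := Real.one_le_exp (TT_nonneg hp n)
  unfold aa; linarith

lemma exp_two : 4 ≤ Real.exp 2 := by
  have h : Real.exp 2 = Real.exp 1 * Real.exp 1 := by rw [← Real.exp_add]; norm_num
  have := Real.add_one_le_exp (1:ℝ)
  nlinarith

lemma log_two_le : Real.log 2 ≤ 1 := by
  have := Real.log_le_sub_one_of_pos (show (0:ℝ) < 2 by norm_num); linarith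

lemma aa_two (hp : ∀ n, 0 < φ n) (n : ℕ) : 2 ≤ aa φ n := by
  have h1 := aa_ge (φ := φ) n
  have h2 : Real.exp 2 ≤ Real.exp (TT φ n) := by
    apply Real.exp_le_exp.2
    rw [TT_eq]; have := SS_pos hp n; have : (0:ℝ) ≤ n := Nat.cast_nonneg n; linarith
  have h3 := exp_two
  have : (2:ℝ) ≤ aa φ n := by linarith
  exact_mod_cast this

lemma aa_dbl (hp : ∀ n, 0 < φ n) (n : ℕ) : 2 * aa φ n ≤ aa φ (n+1) := by
  have h1 := aa_ge (φ := φ) (n+1)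
  have h2 := aa_le hp n
  have h3 : Real.exp (TT φ n) * Real.exp 2 ≤ Real.exp (TT φ (n+1)) := by
    rw [← Real.exp_add]
    apply Real.exp_le_exp.2
    rw [TT_succ]; linarith [hp (n+1)]
  have h4 := exp_two
  have h5 := Real.exp_pos (TT φ n)
  have : 2 * (aa φ n : ℝ) ≤ aa φ (n+1) := by nlinarith
  exact_mod_cast this

lemma logQ_ge (hp : ∀ n, 0 < φ n) (n : ℕ) : Real.exp (AA φ n) ≤ QQ (aa φ) n := by
  rw [AA, Real.exp_sum, QQ, Nat.cast_prod]
  refine prod_le_prod (fun i _ => (Real.exp_pos _).le) fun i _ => ?_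
  refine le_trans (Real.exp_le_exp.2 ?_) (aa_ge i)
  rw [TT_eq]; have : (0:ℝ) ≤ i := Nat.cast_nonneg i; linarith

lemma logQ_le (hp : ∀ n, 0 < φ n) (n : ℕ) :
    (QQ (aa φ) n : ℝ) ≤ Real.exp (AA φ n + 3 * ∑ k ∈ range n, ((k:ℝ)+1)) := by
  rw [AA, mul_sum, ← sum_add_distrib, Real.exp_sum, QQ, Nat.cast_prod]
  refine prod_le_prod (fun i _ => by positivity) fun i _ => ?_
  refine (aa_le hp i).trans ?_
  have : (2:ℝ) ≤ Real.exp 1 := by have := Real.add_one_le_exp (1:ℝ); linarith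
  calc 2 * Real.exp (TT φ i) ≤ Real.exp 1 * Real.exp (TT φ i) :=
        mul_le_mul_of_nonneg_right this (Real.exp_pos _).le
    _ = Real.exp (1 + TT φ i) := by rw [Real.exp_add]
    _ ≤ _ := by
      apply Real.exp_le_exp.2
      rw [TT_eq]; have : (0:ℝ) ≤ i := Nat.cast_nonneg i; linarith

lemma exists_C (hp : ∀ n, 0 < φ n) (h : Tendsto φ atTop atTop) {s : NNReal} (hs1 : s ≤ 1)
    (hs : (s:ENNReal) < 1 / (1 + gammaExp φ)) :
    ∃ C : ℝ, ∀ n, 2 ^ n * (QQ (aa φ) (n+1) : ℝ) ^ (s:ℝ) ≤ C * QQ (aa φ) n := by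
  obtain ⟨δ, hδ, hev⟩ := gamma_lower hp hs
  have hs1' : (s:ℝ) ≤ 1 := by exact_mod_cast hs1
  have hQ : ∀ n, (0:ℝ) < QQ (aa φ) n := fun n => (Real.exp_pos _).trans_le (logQ_ge hp n)
  have hb : ∀ᶠ n in atTop, 2 ^ n * (QQ (aa φ) (n+1) : ℝ) ^ (s:ℝ) / QQ (aa φ) n ≤ 1 := by
    have hq := (tendsto_add_atTop_nat 1).eventually
      (quad_le hp h (show (0:ℝ) < 4 by norm_num) hδ)
    filter_upwards [hev, hq] with n h1 h2
    rw [div_le_one (hQ n)]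
    refine le_trans ?_ (logQ_ge hp n)
    have e1 : (2:ℝ)^n ≤ Real.exp n := by
      have : (2:ℝ) ≤ Real.exp 1 := by have := Real.add_one_le_exp (1:ℝ); linarith
      calc (2:ℝ)^n ≤ Real.exp 1 ^ n := pow_le_pow_left₀ (by norm_num) this n
        _ = _ := by rw [← Real.exp_nat_mul]; simp
    set R := ∑ k ∈ range (n+1), ((k:ℝ)+1) with hR
    have hnR : (n:ℝ) ≤ R := by
      calc (n:ℝ) ≤ ∑ k ∈ range (n+1), (1:ℝ) := by simp
        _ ≤ _ := sum_le_sum fun i _ => by linarith [(Nat.cast_nonneg i : (0:ℝ) ≤ i)]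
    have hR0 : 0 ≤ R := (Nat.cast_nonneg n).trans hnR
    have e2 : (QQ (aa φ) (n+1) : ℝ) ^ (s:ℝ) ≤ Real.exp (s * (AA φ (n+1) + 3 * R)) := by
      calc _ ≤ (Real.exp (AA φ (n+1) + 3 * R)) ^ (s:ℝ) :=
            Real.rpow_le_rpow (hQ _).le (logQ_le hp (n+1)) s.coe_nonneg
        _ = _ := by rw [← Real.exp_mul, mul_comm]
    calc _ ≤ Real.exp n * Real.exp (s * (AA φ (n+1) + 3 * R)) :=
          mul_le_mul e1 e2 (by positivity) (Real.exp_pos _).le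
      _ = Real.exp (n + s * (AA φ (n+1) + 3 * R)) := by rw [Real.exp_add]
      _ ≤ _ := by
        apply Real.exp_le_exp.2
        have : (s:ℝ) * R ≤ 1 * R := mul_le_mul_of_nonneg_right hs1' hR0
        nlinarith
  obtain ⟨C, hC⟩ := (Filter.IsBoundedUnder.bddAbove_range
    (f := fun n => 2 ^ n * (QQ (aa φ) (n+1) : ℝ) ^ (s:ℝ) / QQ (aa φ) n) ⟨1, by simpa using hb⟩)
  refine ⟨C, fun n => ?_⟩
  have := hC ⟨n, rfl⟩
  exact (div_le_iff₀ (hQ n)).1 this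

lemma dig_lim (hp : ∀ n, 0 < φ n) (h : Tendsto φ atTop atTop) (t : ℝ) :
    Tendsto (fun n : ℕ => Real.log ((dig (aa φ) t (n + 1) : ℝ) / (dig (aa φ) t n : ℝ)) / φ (n + 1))
      atTop (nhds 1) := by
  have hb : ∀ n, TT φ n ≤ Real.log (dig (aa φ) t n) ∧ Real.log (dig (aa φ) t n) ≤ TT φ n + 2 := by
    intro n
    have h1 : Real.exp (TT φ n) ≤ dig (aa φ) t n :=
      (aa_ge n).trans (by exact_mod_cast le_dig (aa φ) t n)
    have h2 : (dig (aa φ) t n : ℝ) ≤ Real.exp (TT φ n + 2) := by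
      have h3 : (dig (aa φ) t n : ℝ) ≤ 2 * aa φ n := by
        exact_mod_cast (dig_lt (aa_two hp) t n).le
      have h4 := aa_le hp n
      rw [Real.exp_add]
      have := exp_two
      have := Real.exp_pos (TT φ n)
      nlinarith
    have h0 := (Real.exp_pos _).trans_le h1
    exact ⟨(Real.le_log_iff_exp_le h0).2 h1, (Real.log_le_iff_le_exp h0).2 h2⟩
  have hpos : ∀ n, (dig (aa φ) t n : ℝ) ≠ 0 := fun n => by
    have := (dig_adm (aa_two hp) (aa_dbl hp) t).two_le n
    intro h; linarith
  rw [tendsto_iff_norm_sub_tendsto_zero]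
  have hz : Tendsto (fun n => 4 / φ (n+1)) atTop (nhds 0) :=
    (h.comp (tendsto_add_atTop_nat 1)).const_div_atTop 4
  refine squeeze_zero (fun n => norm_nonneg _) (fun n => ?_) hz
  rw [Real.log_div (hpos _) (hpos _)]
  have h1 := hb n
  have h2 := hb (n+1)
  rw [TT_succ] at h2
  have h3 := hp (n+1)
  rw [Real.norm_eq_abs, div_sub_one h3.ne', abs_div, abs_of_pos h3]
  apply div_le_div_of_nonneg_right _ h3.le
  rw [abs_le]; constructor <;> linarith

/-- the bounded-distortion pieces -/
def FF (φ : ℕ → ℝ) (ε : ℝ) (K : ℕ) : Set ℝ :=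
  {x | ∃ c : ℕ → ℕ, Adm c ∧ (∀ k, |Real.log (c k) - SS φ k| ≤ ε * SS φ k + K) ∧ x = modEngel c}

lemma mem_FF (hp : ∀ n, 0 < φ n) (h : Tendsto φ atTop atTop) {ε : ℝ} (hε : 0 < ε) {c : ℕ → ℕ}
    (hc : Adm c)
    (hl : Tendsto (fun n : ℕ => Real.log ((c (n + 1) : ℝ) / (c n : ℝ)) / φ (n + 1)) atTop
          (nhds 1)) : ∃ K, modEngel c ∈ FF φ ε K := by
  have hpos : ∀ n, (c n : ℝ) ≠ 0 := fun n => by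
    have := hc.two_le n
    intro h; linarith
  have h1 : (fun n : ℕ => Real.log ((c (n + 1) : ℝ) / (c n : ℝ)) - φ (n+1)) =o[atTop]
      (fun n => φ (n+1)) := by
    rw [isLittleO_iff_tendsto (fun n hn => absurd hn (hp _).ne')]
    have := hl.sub_const 1
    rw [sub_self] at this
    refine this.congr fun n => ?_
    rw [div_sub_one (hp _).ne']
  have e1 : ∀ n, ∑ i ∈ range n, φ (i+1) = SS φ n - φ 0 := fun n => by
    rw [SS, sum_range_succ' φ]; ring
  have h2 := h1.sum_range (fun n => (hp _).le) (by
    simp only [e1]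
    exact tendsto_atTop_add_const_right _ (-φ 0) (SS_tendsto hp h))
  have e2 : ∀ n, ∑ i ∈ range n, (Real.log ((c (i + 1) : ℝ) / (c i : ℝ)) - φ (i+1)) =
      Real.log (c n) - SS φ n - (Real.log (c 0) - φ 0) := fun n => by
    rw [sum_sub_distrib, e1]
    have : ∑ i ∈ range n, Real.log ((c (i + 1) : ℝ) / (c i : ℝ)) = Real.log (c n) - Real.log (c 0) := by
      rw [← sum_range_sub (fun i => Real.log (c i))]
      exact sum_congr rfl fun i _ => Real.log_div (hpos _) (hpos _)
    rw [this]; ring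
  have h3 := h2.def hε
  simp only [e1, e2] at h3
  have hb : ∀ᶠ n in atTop, |Real.log (c n) - SS φ n| - ε * SS φ n ≤ |Real.log (c 0) - φ 0| := by
    filter_upwards [h3] with n hn
    have h0 : 0 ≤ SS φ n - φ 0 := by
      rw [← e1]; exact sum_nonneg fun i _ => (hp _).le
    rw [Real.norm_eq_abs, Real.norm_of_nonneg h0] at hn
    have := abs_sub_abs_le_abs_sub (Real.log (c n) - SS φ n) (Real.log (c 0) - φ 0)
    have := hp 0
    nlinarith
  obtain ⟨C, hC⟩ := (Filter.IsBoundedUnder.bddAbove_range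
    (f := fun n => |Real.log (c n) - SS φ n| - ε * SS φ n)
    ⟨|Real.log (c 0) - φ 0|, by simpa using hb⟩)
  obtain ⟨K, hK⟩ := exists_nat_ge C
  refine ⟨K, c, hc, fun k => ?_, rfl⟩
  have := hC ⟨k, rfl⟩
  simp only at this
  linarith

/-- number of digits -/
noncomputable def BB (φ : ℕ → ℝ) (ε : ℝ) (K : ℕ) (i : ℕ) : ℕ :=
  ⌊Real.exp ((1 + ε) * SS φ i + K)⌋₊ + 1

lemma BB_le (hp : ∀ n, 0 < φ n) {ε : ℝ} (hε : 0 < ε) (K : ℕ) (i : ℕ) :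
    (BB φ ε K i : ℝ) ≤ Real.exp ((1 + ε) * SS φ i + (K + 1)) := by
  have h0 : 0 ≤ (1 + ε) * SS φ i + K := by have := SS_pos hp i; positivity
  have h1 := Nat.floor_le (Real.exp_pos ((1 + ε) * SS φ i + K)).le
  have h2 := Real.one_le_exp h0
  have : (2:ℝ) ≤ Real.exp 1 := by have := Real.add_one_le_exp (1:ℝ); linarith
  rw [← add_assoc, Real.exp_add]
  unfold BB; push_cast
  nlinarith

/-- exponent of the cylinder diameter -/
noncomputable def rr (φ : ℕ → ℝ) (ε : ℝ) (K : ℕ) (n : ℕ) : ℝ :=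
  (K + 1) * ((n:ℝ) + 1) - (1 - ε) * AA φ (n+1)

lemma FF_meas (hp : ∀ n, 0 < φ n) (h : Tendsto φ atTop atTop) {ε : ℝ} (hε : 0 < ε) (hε1 : ε < 1)
    (K : ℕ) {s : NNReal} {q : ℝ} (hq : 1 + ε < (1 - ε) * q)
    (hf : ∃ᶠ n in atTop, q * AA φ n ≤ s * AA φ (n+1)) : dimH (FF φ ε K) ≤ s := by
  apply dimH_le_of_hausdorffMeasure_ne_top
  let t : (n : ℕ) → ((i : Fin n) → Fin (BB φ ε K i)) → Set ℝ := fun n p =>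
    {x | ∃ c : ℕ → ℕ, Adm c ∧ (∀ k, |Real.log (c k) - SS φ k| ≤ ε * SS φ k + K) ∧
      (∀ i : Fin n, c i = p i) ∧ x = modEngel c}
  have hlow : ∀ c : ℕ → ℕ, Adm c → (∀ k, |Real.log (c k) - SS φ k| ≤ ε * SS φ k + K) →
      ∀ k, Real.exp ((1 - ε) * SS φ k - K) ≤ c k ∧ (c k : ℝ) ≤ Real.exp ((1 + ε) * SS φ k + K) := by
    intro c hc hb k
    have h0 : (0:ℝ) < c k := by linarith [hc.two_le k]
    have := abs_le.1 (hb k)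
    exact ⟨(Real.le_log_iff_exp_le h0).1 (by linarith), (Real.log_le_iff_le_exp h0).1 (by linarith)⟩
  have hdiam : ∀ n p, Metric.ediam (t n p) ≤ ENNReal.ofReal (Real.exp (rr φ ε K n)) := by
    intro n p
    apply Metric.ediam_le_of_forall_dist_le
    rintro _ ⟨c, hc, hb, hcp, rfl⟩ _ ⟨c', hc', hb', hcp', rfl⟩
    rw [Real.dist_eq]
    have he : ∀ i < n, c i = c' i := fun i hi => by
      rw [hcp ⟨i, hi⟩, hcp' ⟨i, hi⟩]
    refine (close n hc hc' he _ (Real.exp_pos _) (hlow c hc hb n).1 (hlow c' hc' hb' n).1).trans ?_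
    have hprod : Real.exp (∑ i ∈ range n, ((1 - ε) * SS φ i - K)) ≤ ∏ i ∈ range n, (c i : ℝ) := by
      rw [Real.exp_sum]
      exact prod_le_prod (fun i _ => (Real.exp_pos _).le) fun i _ => (hlow c hc hb i).1
    have e1 : (2:ℝ)^(n+1) ≤ Real.exp ((n:ℝ)+1) := by
      have : (2:ℝ) ≤ Real.exp 1 := by have := Real.add_one_le_exp (1:ℝ); linarith
      calc (2:ℝ)^(n+1) ≤ Real.exp 1 ^ (n+1) := pow_le_pow_left₀ (by norm_num) this _
        _ = _ := by rw [← Real.exp_nat_mul]; simp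
    calc _ ≤ Real.exp ((n:ℝ)+1) / (Real.exp (∑ i ∈ range n, ((1 - ε) * SS φ i - K)) *
            Real.exp ((1 - ε) * SS φ n - K)) := by
          apply div_le_div₀ (Real.exp_pos _).le e1 (by positivity)
          exact mul_le_mul_of_nonneg_right hprod (Real.exp_pos _).le
      _ = _ := by
          rw [← Real.exp_add, ← Real.exp_sub, ← sum_range_succ (fun i => (1 - ε) * SS φ i - K),
            sum_sub_distrib, ← mul_sum, rr, AA]
          congr 1
          simp
          ring
  have hr : Tendsto (fun n => ENNReal.ofReal (Real.exp (rr φ ε K n))) atTop (nhds 0) := by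
    rw [← ENNReal.ofReal_zero]
    apply ENNReal.tendsto_ofReal
    apply Real.tendsto_exp_atBot.comp
    have hl := lin_le hp h (show (0:ℝ) < K + 1 by positivity) (show 0 < (1 - ε) / 2 by linarith)
    have hA := AA_tendsto hp h
    have hB : Tendsto (fun n => -((1 - ε) / 2 * AA φ n)) atTop atBot :=
      tendsto_neg_atTop_atBot.comp (hA.const_mul_atTop (show 0 < (1 - ε) / 2 by linarith))
    refine tendsto_atBot_mono' _ ?_ hB
    filter_upwards [hl] with n hn
    rw [rr, AA_succ]
    have := SS_pos hp n
    nlinarith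
  have hle := MeasureTheory.Measure.hausdorffMeasure_le_liminf_sum (s:ℝ) (FF φ ε K) (l := atTop)
    (fun n => ENNReal.ofReal (Real.exp (rr φ ε K n))) hr t
    (Eventually.of_forall fun n => hdiam n) (Eventually.of_forall fun n => by
      rintro x ⟨c, hc, hb, rfl⟩
      rw [Set.mem_iUnion]
      refine ⟨fun i => ⟨c i, ?_⟩, c, hc, hb, fun i => rfl, rfl⟩
      exact Nat.lt_succ_of_le (Nat.le_floor (hlow c hc hb i).2))
  have hfin : liminf (fun n => ∑ p, Metric.ediam (t n p) ^ (s:ℝ)) atTop ≤ 1 := by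
    apply liminf_le_of_frequently_le'
    have hδ : 0 < (1 - ε) * q - (1 + ε) := by linarith
    have hl := lin_le hp h (show (0:ℝ) < (K + 1) * (1 + s) by positivity) hδ
    refine (hf.and_eventually hl).mono ?_
    rintro n ⟨h1, h2⟩
    calc ∑ p, Metric.ediam (t n p) ^ (s:ℝ)
        ≤ ∑ p : ((i : Fin n) → Fin (BB φ ε K i)), ENNReal.ofReal (Real.exp (s * rr φ ε K n)) := by
          apply sum_le_sum
          intro p _
          calc _ ≤ ENNReal.ofReal (Real.exp (rr φ ε K n)) ^ (s:ℝ) :=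
                ENNReal.rpow_le_rpow (hdiam n p) s.coe_nonneg
            _ = _ := by
              rw [ENNReal.ofReal_rpow_of_nonneg (Real.exp_pos _).le s.coe_nonneg, ← Real.exp_mul,
                mul_comm]
      _ = ENNReal.ofReal ((∏ i ∈ range n, (BB φ ε K i : ℝ)) * Real.exp (s * rr φ ε K n)) := by
          rw [sum_const, card_univ, Fintype.card_pi, nsmul_eq_mul,
            ENNReal.ofReal_mul (by positivity)]
          congr 1
          simp only [Fintype.card_fin]
          rw [← ENNReal.ofReal_natCast, Nat.cast_prod, Finset.prod_range]
      _ ≤ ENNReal.ofReal 1 := by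
          apply ENNReal.ofReal_le_ofReal
          have hprod : ∏ i ∈ range n, (BB φ ε K i : ℝ) ≤
              Real.exp ((1 + ε) * AA φ n + n * (K + 1)) := by
            have : (1 + ε) * AA φ n + n * (K + 1) =
                ∑ i ∈ range n, ((1 + ε) * SS φ i + (K + 1)) := by
              rw [sum_add_distrib, ← mul_sum, AA]; simp; ring
            rw [this, Real.exp_sum]
            exact prod_le_prod (fun i _ => by positivity) fun i _ => BB_le hp hε K i
          calc _ ≤ Real.exp ((1 + ε) * AA φ n + n * (K + 1)) * Real.exp (s * rr φ ε K n) :=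
                mul_le_mul_of_nonneg_right hprod (Real.exp_pos _).le
            _ = Real.exp ((1 + ε) * AA φ n + n * (K + 1) + s * rr φ ε K n) := by
                rw [Real.exp_add _ (s * rr φ ε K n)]
            _ ≤ 1 := by
                rw [Real.exp_le_one_iff, rr]
                have h3 : (1 - ε) * (q * AA φ n) ≤ (1 - ε) * (s * AA φ (n+1)) :=
                  mul_le_mul_of_nonneg_left h1 (by linarith)
                have h4 : (0:ℝ) ≤ K := Nat.cast_nonneg K
                nlinarith
      _ = 1 := ENNReal.ofReal_one
  exact ne_top_of_le_ne_top ENNReal.one_ne_top (hle.trans hfin)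

end ME

/-- If `φ(n) → ∞`, then the set of numbers whose modified Engel digits satisfy
`lim log(c_n/c_{n−1})/φ(n) = 1` has Hausdorff dimension `1/(1+γ)`. -/
theorem dimH_modEngel_log_ratio (φ : ℕ → ℝ) (hφpos : ∀ n, 0 < φ n)
    (hφ : Tendsto φ atTop atTop) :
    dimH {x : ℝ | ∃ c : ℕ → ℕ, StrictMono c ∧ 2 ≤ c 0 ∧
        Tendsto (fun n : ℕ => Real.log ((c (n + 1) : ℝ) / (c n : ℝ)) / φ (n + 1)) atTop
          (nhds 1) ∧
        x = modEngel c} = 1 / (1 + gammaExp φ) := by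
  apply le_antisymm
  · apply le_of_forall_gt_imp_ge_of_dense
    intro v hv
    by_cases hvt : v = ⊤
    · rw [hvt]; exact le_top
    obtain ⟨s, rfl⟩ : ∃ s : NNReal, v = s := ⟨_, (ENNReal.coe_toNNReal hvt).symm⟩
    obtain ⟨q, hq, hf⟩ := ME.gamma_upper hφpos hv
    set ε : ℝ := (q - 1) / (2 * (q + 1)) with hεd
    have hε : 0 < ε := div_pos (by linarith) (by linarith)
    have hεq : ε * (q + 1) = (q - 1) / 2 := by
      rw [hεd]; field_simp
    have hε1 : ε < 1 := by
      rw [hεd, div_lt_one (by linarith)]; linarith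
    have hsub : {x : ℝ | ∃ c : ℕ → ℕ, StrictMono c ∧ 2 ≤ c 0 ∧
        Tendsto (fun n : ℕ => Real.log ((c (n + 1) : ℝ) / (c n : ℝ)) / φ (n + 1)) atTop
          (nhds 1) ∧ x = modEngel c} ⊆ ⋃ K, ME.FF φ ε K := by
      rintro _ ⟨c, h1, h2, h3, rfl⟩
      rw [Set.mem_iUnion]
      exact ME.mem_FF hφpos hφ hε ⟨h1, h2⟩ h3
    refine (dimH_mono hsub).trans ?_
    rw [dimH_iUnion]
    exact iSup_le fun K => ME.FF_meas hφpos hφ hε hε1 K (by nlinarith) hf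
  · apply le_of_forall_lt_imp_le_of_dense
    intro v hv
    have hv1 : v ≤ 1 := hv.le.trans (ENNReal.div_le_of_le_mul (by simp))
    obtain ⟨s, rfl⟩ : ∃ s : NNReal, v = s :=
      ⟨_, (ENNReal.coe_toNNReal (ne_top_of_le_ne_top ENNReal.one_ne_top hv1)).symm⟩
    have hs1 : s ≤ 1 := by exact_mod_cast hv1
    rcases eq_or_lt_of_le (bot_le : 0 ≤ s) with h0 | h0
    · rw [← h0]; simp
    obtain ⟨C, hC⟩ := ME.exists_C hφpos hφ hs1 hv
    refine ME.dimH_lower (ME.aa_two hφpos) (ME.aa_dbl hφpos) h0 hs1 hC fun t => ?_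
    have hA := ME.dig_adm (ME.aa_two hφpos) (ME.aa_dbl hφpos) t
    exact ⟨_, hA.1, hA.2, ME.dig_lim hφpos hφ t, rfl⟩
end
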